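/- arXiv:1805.05295 — 2 statements merged into one kernel-verified Lean document; each statement's English description precedes it below -/
import Mathlib

section
/- Let n ≥ 1 and 0 ≤ k ≤ n, let A = S(n,k) be the Hamming sphere, and let N = 2^n. For every function f : 𝔽₂ⁿ → ℝ whose support is contained in A, one has ‖f‖_{u₂}⁴ · ‖f‖₂⁻⁴ ≤ (1/N) · E(A)/|A|², i.e. ‖f‖_{u₂}⁴ · |A|² · N ≤ E(A) · (‖f‖₂²·N)² · N⁻¹ ... concretely: ‖f‖_{u₂}⁴ ≤ (E(A)/(N·|A|²)) · ‖f‖₂⁴. In other words, among functions supported on the Hamming sphere with fixed ℓ² norm, the additive energy ‖f‖_{u₂}⁴ is maximised by the constant function (the indicator of A). -/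
open Finset

/-- Vectors in `𝔽₂ⁿ`. -/
abbrev BV (n : ℕ) := Fin n → ZMod 2

/-- The Hamming sphere `S(n,k)`: vectors of `𝔽₂ⁿ` with exactly `k` ones. -/
def hammingSphere (n k : ℕ) : Finset (BV n) :=
  Finset.univ.filter (fun x => hammingNorm x = k)

/-- The fourth power of the Gowers `u₂` norm (additive energy) of `f`:
the average of `f a₁ f a₂ f a₃ f a₄` over the `N³` quadruples with
`a₁ + a₂ = a₃ + a₄`, where `N = 2ⁿ`. -/
noncomputable def u2pow4 {n : ℕ} (f : BV n → ℝ) : ℝ :=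
  (∑ a₁ : BV n, ∑ a₂ : BV n, ∑ a₃ : BV n, ∑ a₄ : BV n,
      if a₁ + a₂ = a₃ + a₄ then f a₁ * f a₂ * f a₃ * f a₄ else 0) / ((2 : ℝ) ^ n) ^ 3

/-- The square of the `ℓ²` norm: `‖f‖₂² = 𝔼_a f(a)²`. -/
noncomputable def l2sq {n : ℕ} (f : BV n → ℝ) : ℝ := (∑ a : BV n, f a ^ 2) / (2 : ℝ) ^ n

/-- The additive energy `E(A)` of a set `A ⊆ 𝔽₂ⁿ`:
the number of quadruples `(a₁,a₂,a₃,a₄) ∈ A⁴` with `a₁ + a₂ = a₃ + a₄`. -/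
def addEnergy {n : ℕ} (A : Finset (BV n)) : ℕ :=
  ((A ×ˢ A ×ˢ A ×ˢ A).filter
    (fun p => p.1 + p.2.1 = p.2.2.1 + p.2.2.2)).card

noncomputable def sph {n : ℕ} (k : ℤ) (a : BV n) : ℝ := if (hammingNorm a : ℤ) = k then 1 else 0

noncomputable def Tri {n : ℕ} (k₁ k₂ k₃ : ℤ) (f g h : BV n → ℝ) : ℝ :=
  ∑ a : BV n, ∑ b : BV n,
    (sph k₁ a * sph k₂ b * sph k₃ (a + b)) * (f a * g b * h (a + b))

noncomputable def sq2 {n : ℕ} (k : ℤ) (f : BV n → ℝ) : ℝ := ∑ a : BV n, sph k a * f a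

lemma sph_nonneg {n : ℕ} (k : ℤ) (a : BV n) : 0 ≤ sph k a := by
  unfold sph; split_ifs <;> norm_num

lemma bv_add_self {n : ℕ} (a : BV n) : a + a = 0 := by
  funext i
  exact CharTwo.add_self_eq_zero (a i)

lemma bv_add_cancel {n : ℕ} (a b : BV n) : a + (a + b) = b := by
  rw [← add_assoc, bv_add_self, zero_add]

lemma tri_swap12 {n : ℕ} (k₁ k₂ k₃ : ℤ) (f g h : BV n → ℝ) :
    Tri k₁ k₂ k₃ f g h = Tri k₂ k₁ k₃ g f h := by
  unfold Tri
  rw [Finset.sum_comm]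
  refine Finset.sum_congr rfl fun a _ => Finset.sum_congr rfl fun b _ => ?_
  rw [add_comm b a]; ring

lemma tri_swap23 {n : ℕ} (k₁ k₂ k₃ : ℤ) (f g h : BV n → ℝ) :
    Tri k₁ k₂ k₃ f g h = Tri k₁ k₃ k₂ f h g := by
  unfold Tri
  refine Finset.sum_congr rfl fun a _ => ?_
  refine Fintype.sum_equiv (Equiv.addLeft a) _ _ fun b => ?_
  simp only [Equiv.coe_addLeft, bv_add_cancel]
  ring

lemma sum_cons {n : ℕ} (G : BV (n + 1) → ℝ) :
    ∑ a, G a = ∑ a : BV n, G (Fin.cons 0 a) + ∑ a : BV n, G (Fin.cons 1 a) := by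
  rw [← (Fin.consEquiv (fun _ : Fin (n + 1) => ZMod 2)).sum_comp G, Fintype.sum_prod_type]
  exact Fin.sum_univ_two _

lemma cons_add {n : ℕ} (e e' : ZMod 2) (a b : BV n) :
    (Fin.cons e a + Fin.cons e' b : BV (n + 1)) = Fin.cons (e + e') (a + b) := by
  funext i
  refine Fin.cases ?_ (fun j => ?_) i <;> simp

lemma norm_cons0 {n : ℕ} (a : BV n) :
    hammingNorm (Fin.cons 0 a : BV (n + 1)) = hammingNorm a := by
  simp only [hammingNorm, Finset.card_filter]
  rw [Fin.sum_univ_succ]; simp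

lemma norm_cons1 {n : ℕ} (a : BV n) :
    hammingNorm (Fin.cons 1 a : BV (n + 1)) = hammingNorm a + 1 := by
  simp only [hammingNorm, Finset.card_filter]
  rw [Fin.sum_univ_succ]; simp [add_comm]

lemma sph_cons0 {n : ℕ} (k : ℤ) (a : BV n) :
    sph k (Fin.cons 0 a : BV (n + 1)) = sph k a := by
  simp only [sph, norm_cons0]

lemma sph_cons1 {n : ℕ} (k : ℤ) (a : BV n) :
    sph k (Fin.cons 1 a : BV (n + 1)) = sph (k - 1) a := by
  simp only [sph, norm_cons1, Nat.cast_add, Nat.cast_one, eq_sub_iff_add_eq]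

lemma sq2_cons {n : ℕ} (k : ℤ) (f : BV (n + 1) → ℝ) :
    sq2 k f = sq2 k (fun a => f (Fin.cons 0 a)) + sq2 (k - 1) (fun a => f (Fin.cons 1 a)) := by
  unfold sq2
  rw [sum_cons]
  simp only [sph_cons0, sph_cons1]

lemma tri_cons {n : ℕ} (k₁ k₂ k₃ : ℤ) (f g h : BV (n + 1) → ℝ) :
    Tri k₁ k₂ k₃ f g h =
      Tri k₁ k₂ k₃ (fun a => f (Fin.cons 0 a)) (fun a => g (Fin.cons 0 a)) (fun a => h (Fin.cons 0 a))
      + Tri k₁ (k₂ - 1) (k₃ - 1)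
        (fun a => f (Fin.cons 0 a)) (fun a => g (Fin.cons 1 a)) (fun a => h (Fin.cons 1 a))
      + Tri (k₁ - 1) k₂ (k₃ - 1)
        (fun a => f (Fin.cons 1 a)) (fun a => g (Fin.cons 0 a)) (fun a => h (Fin.cons 1 a))
      + Tri (k₁ - 1) (k₂ - 1) k₃
        (fun a => f (Fin.cons 1 a)) (fun a => g (Fin.cons 1 a)) (fun a => h (Fin.cons 0 a)) := by
  have h11 : (1 + 1 : ZMod 2) = 0 := by decide
  unfold Tri
  rw [sum_cons]
  simp only [sum_cons (n := n), cons_add, sph_cons0, sph_cons1, add_zero, zero_add, h11,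
    Finset.sum_add_distrib]
  ring

lemma exists_perm {n : ℕ} (a a' : BV n) (h : hammingNorm a = hammingNorm a') :
    ∃ σ : Equiv.Perm (Fin n), ∀ i, a' (σ i) = a i := by
  have hc : Fintype.card {i // a i ≠ 0} = Fintype.card {i // a' i ≠ 0} := by
    rw [Fintype.card_subtype, Fintype.card_subtype]; exact h
  let e := Fintype.equivOfCardEq hc
  refine ⟨e.extendSubtype, fun i => ?_⟩
  have two : ∀ x y : ZMod 2, x ≠ 0 → y ≠ 0 → x = y := by decide
  by_cases hi : a i ≠ 0
  · exact two _ _ (e.extendSubtype_mem i hi) hi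
  · have := e.extendSubtype_not_mem i hi
    simp only [ne_eq, not_not] at this hi
    rw [this, hi]

lemma sph_perm {n : ℕ} (k : ℤ) (a : BV n) (σ : Equiv.Perm (Fin n)) :
    sph k (fun i => a (σ i)) = sph k a := by
  have : hammingNorm (fun i => a (σ i)) = hammingNorm a := by
    simp only [hammingNorm, Finset.card_filter]
    exact Equiv.sum_comp σ (fun i => if a i ≠ 0 then 1 else 0)
  simp only [sph, this]

noncomputable def dg {n : ℕ} (k₂ k₃ : ℤ) (a : BV n) : ℝ := ∑ b : BV n, sph k₂ b * sph k₃ (a + b)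

lemma dg_const {n : ℕ} (k₂ k₃ : ℤ) (a a' : BV n) (h : hammingNorm a = hammingNorm a') :
    dg k₂ k₃ a = dg k₂ k₃ a' := by
  obtain ⟨σ, hσ⟩ := exists_perm a a' h
  unfold dg
  symm
  refine Fintype.sum_equiv (Equiv.arrowCongr σ.symm (Equiv.refl _)) _ _ fun b => ?_
  have e : (Equiv.arrowCongr σ.symm (Equiv.refl (ZMod 2))) b = fun i => b (σ i) := by
    funext i; simp [Equiv.arrowCongr]
  rw [e, sph_perm]
  congr 1
  rw [← sph_perm k₃ (a' + b) σ]
  congr 1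
  funext i
  simp [hσ]

lemma marg {n : ℕ} (k₁ k₂ k₃ : ℤ) :
    ∃ D : ℝ, ∀ f : BV n → ℝ, Tri k₁ k₂ k₃ f 1 1 = D * sq2 k₁ f := by
  have key : ∀ f : BV n → ℝ, Tri k₁ k₂ k₃ f 1 1 = ∑ a, dg k₂ k₃ a * (sph k₁ a * f a) := by
    intro f
    unfold Tri dg
    refine Finset.sum_congr rfl fun a _ => ?_
    rw [Finset.sum_mul]
    refine Finset.sum_congr rfl fun b _ => ?_
    simp only [Pi.one_apply]; ring
  by_cases hx : ∃ a : BV n, (hammingNorm a : ℤ) = k₁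
  · obtain ⟨a₀, h₀⟩ := hx
    refine ⟨dg k₂ k₃ a₀, fun f => ?_⟩
    rw [key, sq2, Finset.mul_sum]
    refine Finset.sum_congr rfl fun a _ => ?_
    by_cases ha : (hammingNorm a : ℤ) = k₁
    · rw [dg_const k₂ k₃ a a₀ (by exact_mod_cast ha.trans h₀.symm)]
    · simp [sph, ha]
  · refine ⟨0, fun f => ?_⟩
    rw [key, zero_mul]
    refine Finset.sum_eq_zero fun a _ => ?_
    have ha : ¬ (hammingNorm a : ℤ) = k₁ := fun h => hx ⟨a, h⟩
    simp [sph, ha]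

lemma sq2_nonneg {n : ℕ} (k : ℤ) (f : BV n → ℝ) (hf : ∀ a, 0 ≤ f a) : 0 ≤ sq2 k f :=
  Finset.sum_nonneg fun a _ => mul_nonneg (sph_nonneg k a) (hf a)

lemma tri_one_nonneg {n : ℕ} (k₁ k₂ k₃ : ℤ) : 0 ≤ Tri (n := n) k₁ k₂ k₃ 1 1 1 := by
  refine Finset.sum_nonneg fun a _ => Finset.sum_nonneg fun b _ => ?_
  have := sph_nonneg k₁ a
  have := sph_nonneg k₂ b
  have := sph_nonneg k₃ (a + b)
  simp only [Pi.one_apply]; positivity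

/-- the two-point inequality -/
lemma two_point (α β γ δ x0 x1 y0 y1 z0 z1 : ℝ) (hα : 0 ≤ α) (hβ : 0 ≤ β) (hγ : 0 ≤ γ)
    (hδ : 0 ≤ δ) :
    (δ * (x0 * y0 * z0) + γ * (x0 * y1 * z1) + β * (x1 * y0 * z1) + α * (x1 * y1 * z0)) ^ 2
      * (δ + γ + β + α) ≤
    ((δ + γ) * x0 ^ 2 + (β + α) * x1 ^ 2) * ((δ + β) * y0 ^ 2 + (γ + α) * y1 ^ 2)
      * ((δ + α) * z0 ^ 2 + (γ + β) * z1 ^ 2) := by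
  rcases eq_or_lt_of_le (add_nonneg hδ hα) with hs | hs
  · have h1 : δ = 0 := by linarith
    have h2 : α = 0 := by linarith
    subst h1 h2
    have : 0 ≤ γ * β * (x0 * y0 - x1 * y1) ^ 2 * ((γ + β) * z1 ^ 2) := by positivity
    nlinarith [this]
  rcases eq_or_lt_of_le (add_nonneg hγ hβ) with ht | ht
  · have h1 : γ = 0 := by linarith
    have h2 : β = 0 := by linarith
    subst h1 h2
    have : 0 ≤ δ * α * (x0 * y1 - x1 * y0) ^ 2 * ((δ + α) * z0 ^ 2) := by positivity
    nlinarith [this]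
  set P := δ * (x0 * y0) + α * (x1 * y1) with hP
  set Q := γ * (x0 * y1) + β * (x1 * y0) with hQ
  set W := ((δ + γ) * x0 ^ 2 + (β + α) * x1 ^ 2) * ((δ + β) * y0 ^ 2 + (γ + α) * y1 ^ 2) with hW
  have c1 : (δ + γ + β + α) * ((γ + β) * P ^ 2 + (δ + α) * Q ^ 2) ≤ (δ + α) * (γ + β) * W := by
    have e : (δ + α) * (γ + β) * W - (δ + γ + β + α) * ((γ + β) * P ^ 2 + (δ + α) * Q ^ 2)
      = (α * δ * (γ + β) + β * γ * (δ + α)) *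
        ((γ + β) * (x0 * y0 - x1 * y1) ^ 2 + (δ + α) * (x0 * y1 - x1 * y0) ^ 2) := by
      rw [hP, hQ, hW]; ring
    have : 0 ≤ (α * δ * (γ + β) + β * γ * (δ + α)) *
        ((γ + β) * (x0 * y0 - x1 * y1) ^ 2 + (δ + α) * (x0 * y1 - x1 * y0) ^ 2) := by positivity
    linarith
  have c2 : (z0 * P + z1 * Q) ^ 2 * ((δ + α) * (γ + β)) ≤
      ((δ + α) * z0 ^ 2 + (γ + β) * z1 ^ 2) * ((γ + β) * P ^ 2 + (δ + α) * Q ^ 2) := by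
    nlinarith [sq_nonneg ((δ + α) * z0 * Q - (γ + β) * z1 * P)]
  have e3 : δ * (x0 * y0 * z0) + γ * (x0 * y1 * z1) + β * (x1 * y0 * z1) + α * (x1 * y1 * z0)
      = z0 * P + z1 * Q := by rw [hP, hQ]; ring
  rw [e3]
  have hst : 0 < (δ + α) * (γ + β) := mul_pos hs ht
  have hz : 0 ≤ (δ + α) * z0 ^ 2 + (γ + β) * z1 ^ 2 := by positivity
  refine le_of_mul_le_mul_left ?_ hst
  calc (δ + α) * (γ + β) * ((z0 * P + z1 * Q) ^ 2 * (δ + γ + β + α))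
      = ((z0 * P + z1 * Q) ^ 2 * ((δ + α) * (γ + β))) * (δ + γ + β + α) := by ring
    _ ≤ (((δ + α) * z0 ^ 2 + (γ + β) * z1 ^ 2) * ((γ + β) * P ^ 2 + (δ + α) * Q ^ 2))
          * (δ + γ + β + α) := mul_le_mul_of_nonneg_right c2 (by positivity)
    _ = ((δ + α) * z0 ^ 2 + (γ + β) * z1 ^ 2) *
          ((δ + γ + β + α) * ((γ + β) * P ^ 2 + (δ + α) * Q ^ 2)) := by ring
    _ ≤ ((δ + α) * z0 ^ 2 + (γ + β) * z1 ^ 2) * ((δ + α) * (γ + β) * W) :=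
        mul_le_mul_of_nonneg_left c1 hz
    _ = _ := by ring

lemma sq2_zero {n : ℕ} (k : ℤ) (f : BV n → ℝ) (h : sq2 (n := n) k 1 = 0) : sq2 k f = 0 := by
  unfold sq2 at *
  rw [Finset.sum_eq_zero_iff_of_nonneg
    (fun a _ => mul_nonneg (sph_nonneg k a) (by simp))] at h
  refine Finset.sum_eq_zero fun a ha => ?_
  have := h a ha
  simp only [Pi.one_apply, mul_one] at this
  rw [this, zero_mul]

lemma mul_sq2_div {n : ℕ} (k : ℤ) (f : BV n → ℝ) :
    sq2 (n := n) k 1 * (sq2 k f / sq2 (n := n) k 1) = sq2 k f := by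
  by_cases h : sq2 (n := n) k 1 = 0
  · rw [sq2_zero k f h, h]; simp
  · field_simp

lemma comp_one {n : ℕ} (e : ZMod 2) :
    (fun a : BV n => (1 : BV (n + 1) → ℝ) (Fin.cons e a)) = 1 := rfl

lemma tri_zero {n : ℕ} (k₁ k₂ k₃ : ℤ) (g h : BV n → ℝ) : Tri k₁ k₂ k₃ 0 g h = 0 := by
  simp [Tri]

/-- marginal recursion -/
lemma marg_rec {n : ℕ} (k₁ k₂ k₃ : ℤ) (f : BV (n + 1) → ℝ) :
    (Tri (n := n) k₁ k₂ k₃ 1 1 1 + Tri (n := n) k₁ (k₂ - 1) (k₃ - 1) 1 1 1)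
        * (sq2 k₁ (fun a => f (Fin.cons 0 a)) / sq2 (n := n) k₁ 1)
      + (Tri (n := n) (k₁ - 1) k₂ (k₃ - 1) 1 1 1 + Tri (n := n) (k₁ - 1) (k₂ - 1) k₃ 1 1 1)
        * (sq2 (k₁ - 1) (fun a => f (Fin.cons 1 a)) / sq2 (n := n) (k₁ - 1) 1)
      = Tri (n := n + 1) k₁ k₂ k₃ 1 1 1 * (sq2 k₁ f / sq2 (n := n + 1) k₁ 1) := by
  obtain ⟨D, hD⟩ := marg (n := n + 1) k₁ k₂ k₃
  have h0 := hD (fun a => if a 0 = 0 then 1 else 0)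
  have h1 := hD (fun a => if a 0 = 0 then 0 else 1)
  have z : (fun _ : BV n => (0 : ℝ)) = 0 := rfl
  have o : (fun _ : BV n => (1 : ℝ)) = 1 := rfl
  have s0 : sq2 (n := n) k₁ 0 = 0 := by simp [sq2]
  have s1 : sq2 (n := n) (k₁ - 1) 0 = 0 := by simp [sq2]
  rw [tri_cons, sq2_cons] at h0 h1
  simp only [Fin.cons_zero, if_true, one_ne_zero, if_false, comp_one, z, o, tri_zero, s0, s1,
    add_zero, zero_add] at h0 h1
  rw [h0, h1, hD 1, mul_assoc, mul_assoc, mul_assoc, mul_sq2_div, mul_sq2_div, mul_sq2_div,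
    sq2_cons k₁ f]
  ring

noncomputable def nm {n : ℕ} (k : ℤ) (f : BV n → ℝ) : ℝ :=
  √(sq2 k (fun a => f a ^ 2) / sq2 (n := n) k 1)

lemma nm_sq {n : ℕ} (k : ℤ) (f : BV n → ℝ) :
    nm k f ^ 2 = sq2 k (fun a => f a ^ 2) / sq2 (n := n) k 1 := by
  refine Real.sq_sqrt (div_nonneg (sq2_nonneg _ _ fun a => sq_nonneg _) (sq2_nonneg _ _ fun a => ?_))
  simp

lemma nm_nonneg {n : ℕ} (k : ℤ) (f : BV n → ℝ) : 0 ≤ nm k f := Real.sqrt_nonneg _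

lemma tri_one_perm {n : ℕ} (k₁ k₂ k₃ : ℤ) :
    Tri (n := n) k₃ k₁ k₂ 1 1 1 = Tri (n := n) k₁ k₂ k₃ 1 1 1 := by
  rw [tri_swap12, tri_swap23]

lemma tri_main (n : ℕ) : ∀ (k₁ k₂ k₃ : ℤ) (f g h : BV n → ℝ),
    Tri k₁ k₂ k₃ f g h ≤ Tri (n := n) k₁ k₂ k₃ 1 1 1 * (nm k₁ f * nm k₂ g * nm k₃ h) := by
  induction n with
  | zero =>
    intro k₁ k₂ k₃ f g h
    have hs : ∀ (k : ℤ) (x : BV 0), sph k x = if 0 = k then 1 else 0 := by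
      intro k x; simp [sph, hammingNorm]
    by_cases h1 : (0 : ℤ) = k₁
    · by_cases h2 : (0 : ℤ) = k₂
      · by_cases h3 : (0 : ℤ) = k₃
        · subst h1; subst h2; subst h3
          simp only [Tri, nm, sq2, hs, Fintype.sum_unique, if_true, Pi.one_apply, one_mul, mul_one,
            div_one, Real.sqrt_sq_eq_abs]
          refine (le_abs_self _).trans (le_of_eq ?_)
          rw [abs_mul, abs_mul]
          congr 2
          exact congrArg h (Subsingleton.elim _ _)
        · simp [Tri, hs, h3]
      · simp [Tri, hs, h2]
    · simp [Tri, hs, h1]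
  | succ n ih =>
    intro k₁ k₂ k₃ f g h
    have hx := marg_rec k₁ k₂ k₃ (fun a => f a ^ 2)
    have hy := marg_rec k₂ k₁ k₃ (fun a => g a ^ 2)
    have hz := marg_rec k₃ k₁ k₂ (fun a => h a ^ 2)
    simp only [← nm_sq] at hx hy hz
    rw [tri_swap12 k₂ k₁ k₃, tri_swap12 k₂ (k₁ - 1) (k₃ - 1), tri_swap12 (k₂ - 1) k₁ (k₃ - 1),
      tri_swap12 (k₂ - 1) (k₁ - 1) k₃, tri_swap12 k₂ k₁ k₃] at hy
    rw [tri_one_perm k₁ k₂ k₃, tri_one_perm (k₁ - 1) (k₂ - 1) k₃, tri_one_perm k₁ (k₂ - 1) (k₃ - 1),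
      tri_one_perm (k₁ - 1) k₂ (k₃ - 1), tri_one_perm k₁ k₂ k₃] at hz
    have hT := tri_cons (n := n) k₁ k₂ k₃ 1 1 1
    simp only [comp_one] at hT
    rw [tri_cons k₁ k₂ k₃ f g h]
    have i1 := ih k₁ k₂ k₃ (fun a => f (Fin.cons 0 a)) (fun a => g (Fin.cons 0 a))
      (fun a => h (Fin.cons 0 a))
    have i2 := ih k₁ (k₂ - 1) (k₃ - 1) (fun a => f (Fin.cons 0 a)) (fun a => g (Fin.cons 1 a))
      (fun a => h (Fin.cons 1 a))
    have i3 := ih (k₁ - 1) k₂ (k₃ - 1) (fun a => f (Fin.cons 1 a)) (fun a => g (Fin.cons 0 a))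
      (fun a => h (Fin.cons 1 a))
    have i4 := ih (k₁ - 1) (k₂ - 1) k₃ (fun a => f (Fin.cons 1 a)) (fun a => g (Fin.cons 1 a))
      (fun a => h (Fin.cons 0 a))
    have p1 := tri_one_nonneg (n := n) k₁ k₂ k₃
    have p2 := tri_one_nonneg (n := n) k₁ (k₂ - 1) (k₃ - 1)
    have p3 := tri_one_nonneg (n := n) (k₁ - 1) k₂ (k₃ - 1)
    have p4 := tri_one_nonneg (n := n) (k₁ - 1) (k₂ - 1) k₃
    refine (add_le_add (add_le_add (add_le_add i1 i2) i3) i4).trans ?_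
    clear i1 i2 i3 i4
    have nf := nm_nonneg k₁ f
    have ng := nm_nonneg k₂ g
    have nh := nm_nonneg k₃ h
    generalize nm k₁ f = X at *
    generalize nm k₂ g = Y at *
    generalize nm k₃ h = Z at *
    generalize nm k₁ (fun a => f (Fin.cons 0 a)) = x0 at *
    generalize nm (k₁ - 1) (fun a => f (Fin.cons 1 a)) = x1 at *
    generalize nm k₂ (fun a => g (Fin.cons 0 a)) = y0 at *
    generalize nm (k₂ - 1) (fun a => g (Fin.cons 1 a)) = y1 at *
    generalize nm k₃ (fun a => h (Fin.cons 0 a)) = z0 at *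
    generalize nm (k₃ - 1) (fun a => h (Fin.cons 1 a)) = z1 at *
    generalize Tri (n := n + 1) k₁ k₂ k₃ 1 1 1 = T at *
    generalize Tri (n := n) k₁ k₂ k₃ 1 1 1 = δ at *
    generalize Tri (n := n) k₁ (k₂ - 1) (k₃ - 1) 1 1 1 = γ at *
    generalize Tri (n := n) (k₁ - 1) k₂ (k₃ - 1) 1 1 1 = β at *
    generalize Tri (n := n) (k₁ - 1) (k₂ - 1) k₃ 1 1 1 = α at *
    have tp := two_point α β γ δ x0 x1 y0 y1 z0 z1 p4 p3 p2 p1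
    rw [hx, hy, hz, ← hT] at tp
    rcases eq_or_lt_of_le (show 0 ≤ T by linarith) with h0 | h0
    · have a1 : α = 0 := by linarith
      have a2 : β = 0 := by linarith
      have a3 : γ = 0 := by linarith
      have a4 : δ = 0 := by linarith
      simp [a1, a2, a3, a4, ← h0]
    · refine (le_abs_self _).trans (abs_le_of_sq_le_sq ?_ (by positivity))
      refine le_of_mul_le_mul_right (tp.trans (le_of_eq ?_)) h0
      ring

noncomputable def cf {n : ℕ} (f : BV n → ℝ) (d : BV n) : ℝ := ∑ a : BV n, f a * f (a + d)

lemma conv_sum {n : ℕ} (f w : BV n → ℝ) :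
    ∑ a : BV n, ∑ b : BV n, f a * f b * w (a + b) = ∑ d, cf f d * w d := by
  have : ∀ a : BV n, ∑ b : BV n, f a * f b * w (a + b) = ∑ d, f a * f (a + d) * w d := by
    intro a
    refine Fintype.sum_equiv (Equiv.addLeft a) _ _ fun b => ?_
    simp only [Equiv.coe_addLeft, bv_add_cancel]
  simp only [this, cf, Finset.sum_mul]
  exact Finset.sum_comm

lemma quad_sum {n : ℕ} (f : BV n → ℝ) :
    (∑ a₁ : BV n, ∑ a₂ : BV n, ∑ a₃ : BV n, ∑ a₄ : BV n,
      if a₁ + a₂ = a₃ + a₄ then f a₁ * f a₂ * f a₃ * f a₄ else 0) = ∑ d, cf f d ^ 2 := by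
  simp only [pow_two]
  rw [← conv_sum f (cf f)]
  refine Finset.sum_congr rfl fun a _ => Finset.sum_congr rfl fun b _ => ?_
  rw [cf, Finset.mul_sum]
  refine Finset.sum_congr rfl fun c _ => ?_
  have : ∀ d, (a + b = c + d) ↔ (c + (a + b) = d) := by
    intro d
    constructor
    · intro h; rw [h, bv_add_cancel]
    · intro h; rw [← h, bv_add_cancel]
  simp only [this]
  rw [Finset.sum_ite_eq]
  simp only [Finset.mem_univ, if_true]
  ring

lemma sum_sph {n : ℕ} (d : BV n) : ∑ j ∈ Finset.range (n + 1), sph (j : ℤ) d = 1 := by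
  have : hammingNorm d < n + 1 := by
    have := hammingNorm_le_card_fintype (x := d)
    simp at this; omega
  simp only [sph, Nat.cast_inj]
  rw [Finset.sum_ite_eq]
  simp [this]

lemma split_sum {n : ℕ} (w : BV n → ℝ) :
    ∑ d, w d = ∑ j ∈ Finset.range (n + 1), sq2 (j : ℤ) w := by
  unfold sq2
  rw [Finset.sum_comm]
  refine Finset.sum_congr rfl fun d _ => ?_
  rw [← Finset.sum_mul, sum_sph, one_mul]

lemma tri_cf {n : ℕ} (k j : ℤ) (f w : BV n → ℝ) (hf : ∀ a, sph k a * f a = f a) :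
    Tri k k j f f w = sq2 j (fun d => cf f d * w d) := by
  have : Tri k k j f f w = ∑ a : BV n, ∑ b : BV n, f a * f b * (sph j (a + b) * w (a + b)) := by
    refine Finset.sum_congr rfl fun a _ => Finset.sum_congr rfl fun b _ => ?_
    calc _ = (sph k a * f a) * (sph k b * f b) * (sph j (a + b) * w (a + b)) := by ring
      _ = _ := by rw [hf a, hf b]
  rw [this, conv_sum f (fun d => sph j d * w d)]
  refine Finset.sum_congr rfl fun a _ => by ring

lemma sph_sq {n : ℕ} (k : ℤ) (a : BV n) : sph k a * sph k a = sph k a := by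
  unfold sph; split_ifs <;> norm_num

lemma level {n : ℕ} (k j : ℤ) (f : BV n → ℝ) (hf : ∀ a, sph k a * f a = f a) :
    sq2 j (fun d => cf f d ^ 2) ≤
      sq2 j (fun d => cf (sph (n := n) k) d ^ 2) * (nm k f ^ 2) ^ 2 := by
  have h1 := tri_main n k k j f f (cf f)
  rw [tri_cf k j f _ hf] at h1
  simp only [← pow_two] at h1
  have e : Tri (n := n) k k j 1 1 1 = sq2 j (cf (sph (n := n) k)) := by
    have := tri_cf k j (sph (n := n) k) 1 (sph_sq k)
    simp only [Pi.one_apply, mul_one] at this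
    rw [← this]
    refine Finset.sum_congr rfl fun a _ => Finset.sum_congr rfl fun b _ => ?_
    have ha := sph_sq k a
    have hb := sph_sq k b
    simp only [Pi.one_apply, mul_one]
    linear_combination (-sph j (a + b) * sph k b * sph k b) * ha
      - (sph j (a + b) * sph k a) * hb
  have cs : sq2 j (cf (sph (n := n) k)) ^ 2 ≤
      sq2 (n := n) j 1 * sq2 j (fun d => cf (sph (n := n) k) d ^ 2) := by
    have := Finset.sum_mul_sq_le_sq_mul_sq Finset.univ (fun d : BV n => sph j d)
      (fun d => sph j d * cf (sph (n := n) k) d)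
    have e1 : ∀ d : BV n, sph j d * (sph j d * cf (sph (n := n) k) d)
        = sph j d * cf (sph (n := n) k) d := fun d => by rw [← mul_assoc, sph_sq]
    have e2 : ∀ d : BV n, (sph j d * cf (sph (n := n) k) d) ^ 2
        = sph j d * cf (sph (n := n) k) d ^ 2 := fun d => by rw [mul_pow, pow_two (sph j d), sph_sq]
    have e3 : ∀ d : BV n, sph j d ^ 2 = sph j d := fun d => by rw [pow_two, sph_sq]
    unfold sq2
    simp only [e1, e2, e3] at this
    simpa only [Pi.one_apply, mul_one] using this
  rw [e] at h1
  have m := nm_sq j (cf f)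
  have hE : 0 ≤ sq2 j (fun d => cf f d ^ 2) := sq2_nonneg _ _ fun a => sq_nonneg _
  have hA : 0 ≤ sq2 j (fun d => cf (sph (n := n) k) d ^ 2) := sq2_nonneg _ _ fun a => sq_nonneg _
  have hS : 0 ≤ sq2 (n := n) j 1 := sq2_nonneg _ _ fun a => by simp
  rcases eq_or_lt_of_le hE with h0 | h0
  · rw [← h0]; positivity
  rcases eq_or_lt_of_le hS with hs | hs
  · rw [sq2_zero _ _ hs.symm] at h0; exact absurd h0 (lt_irrefl _)
  have h2 := pow_le_pow_left₀ hE h1 2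
  generalize sq2 j (fun d => cf f d ^ 2) = E at *
  generalize sq2 j (fun d => cf (sph (n := n) k) d ^ 2) = A at *
  generalize sq2 (n := n) j 1 = S at *
  generalize sq2 j (cf (sph (n := n) k)) = T at *
  generalize nm k f = X at *
  refine le_of_mul_le_mul_left ?_ h0
  calc E * E = E ^ 2 := by ring
    _ ≤ _ := h2
    _ = T ^ 2 * (X ^ 2) ^ 2 * (E / S) := by rw [← m]; ring
    _ ≤ (S * A) * (X ^ 2) ^ 2 * (E / S) := by gcongr
    _ = _ := by field_simp

lemma mem_sphere {n k : ℕ} (a : BV n) :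
    sph (k : ℤ) a = if a ∈ hammingSphere n k then 1 else 0 := by
  simp [sph, hammingSphere]

lemma energy_eq {n k : ℕ} :
    (addEnergy (hammingSphere n k) : ℝ) = ∑ d, cf (sph (n := n) (k : ℤ)) d ^ 2 := by
  have hsum : ∀ G : BV n → ℝ, ∑ a ∈ hammingSphere n k, G a = ∑ a, sph (k : ℤ) a * G a := by
    intro G
    simp [mem_sphere]
  rw [← quad_sum, _root_.addEnergy, Finset.card_filter]
  push_cast
  simp only [Finset.sum_product, hsum, Finset.mul_sum]
  refine Finset.sum_congr rfl fun a _ => Finset.sum_congr rfl fun b _ =>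
    Finset.sum_congr rfl fun c _ => Finset.sum_congr rfl fun d _ => ?_
  split_ifs <;> ring

/-- For every `f` supported on the Hamming sphere `A = S(n,k)`,
`‖f‖_{u₂}⁴ ≤ (E(A)/(N·|A|²)) · ‖f‖₂⁴` with `N = 2ⁿ`. -/
theorem u2_max_on_sphere (n k : ℕ) (hn : 1 ≤ n) (hk : k ≤ n)
    (f : BV n → ℝ) (hf : Function.support f ⊆ (hammingSphere n k : Set (BV n))) :
    u2pow4 f ≤
      ((addEnergy (hammingSphere n k) : ℝ) /
        ((2 : ℝ) ^ n * ((hammingSphere n k).card : ℝ) ^ 2)) * (l2sq f) ^ 2 := by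
  have hs : ∀ a, sph (k : ℤ) a * f a = f a := by
    intro a
    rw [mem_sphere]
    by_cases h : f a = 0
    · simp [h]
    · have : a ∈ hammingSphere n k := by exact_mod_cast hf h
      simp [this]
  have hc : sq2 (n := n) (k : ℤ) 1 = ((hammingSphere n k).card : ℝ) := by
    simp [sq2, mem_sphere]
  have h2 : sq2 (k : ℤ) (fun a => f a ^ 2) = ∑ a, f a ^ 2 := by
    refine Finset.sum_congr rfl fun a _ => ?_
    simp only [pow_two, ← mul_assoc, hs]
  have key : ∑ d, cf f d ^ 2 ≤ (addEnergy (hammingSphere n k) : ℝ) * (nm (k : ℤ) f ^ 2) ^ 2 := by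
    rw [energy_eq, split_sum, split_sum, Finset.sum_mul]
    exact Finset.sum_le_sum fun j _ => level _ _ f hs
  rw [nm_sq, hc, h2] at key
  unfold u2pow4 l2sq
  rw [quad_sum]
  refine (div_le_div_of_nonneg_right key (by positivity)).trans (le_of_eq ?_)
  generalize (2 : ℝ) ^ n = N
  simp only [div_eq_mul_inv, mul_inv, mul_pow, inv_pow]
  ring
end

section
/- Let n ≥ 1, 0 ≤ k ≤ n, and A = S(n,k) the Hamming sphere. For every function f : 𝔽₂ⁿ → ℝ supported on A, ‖f‖_{u₂}⁴ · ‖𝟙_A‖₂⁴ ≤ ‖𝟙_A‖_{u₂}⁴ · ‖f‖₂⁴, where 𝟙_A is the indicator function of A. That is, the ratio ‖f‖_{u₂}⁴/‖f‖₂⁴ over nonzero functions supported on A achieves its maximum at the constant function 𝟙_A. -/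
open Finset

abbrev P4 := Fin 4 → ZMod 2

lemma sumZ {M : Type*} [AddCommMonoid M] (g : ZMod 2 → M) : ∑ b, g b = g 0 + g 1 :=
  Fin.sum_univ_two g

lemma sumCons {M : Type*} [AddCommMonoid M] {n : ℕ} {α : Type*} [Fintype α]
    (g : (Fin (n+1) → α) → M) :
    ∑ a, g a = ∑ b : α, ∑ a : Fin n → α, g (Fin.cons b a) := by
  rw [← (Fin.consEquiv (fun _ : Fin (n+1) => α)).sum_comp, Fintype.sum_prod_type]
  rfl

/-- evaluation on the eight even patterns -/
lemma sumP4 (g : P4 → ℝ) (h : ∀ e : P4, ∑ j, e j ≠ 0 → g e = 0) :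
    ∑ e, g e = g ![0,0,0,0] + g ![1,1,1,1] + g ![1,1,0,0] + g ![0,0,1,1]
      + g ![1,0,1,0] + g ![0,1,0,1] + g ![1,0,0,1] + g ![0,1,1,0] := by
  have key : ∀ x y z t : ZMod 2, ∀ a : Fin 0 → ZMod 2,
      (Fin.cons x (Fin.cons y (Fin.cons z (Fin.cons t a : Fin 1 → ZMod 2) : Fin 2 → ZMod 2)
        : Fin 3 → ZMod 2) : P4) = ![x,y,z,t] := by
    intro x y z t a
    have : a = ![] := Subsingleton.elim _ _
    subst this; rfl
  simp only [sumCons, sumZ, key, Finset.univ_unique, Finset.sum_singleton]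
  rw [h ![0,0,0,1] (by decide), h ![0,0,1,0] (by decide), h ![0,1,0,0] (by decide),
    h ![1,0,0,0] (by decide), h ![1,1,1,0] (by decide), h ![1,1,0,1] (by decide),
    h ![1,0,1,1] (by decide), h ![0,1,1,1] (by decide)]
  ring

lemma row_bound (aa a2 a3 a4 b0 b2 b3 b4 : ℝ) (h1 : 0 ≤ aa) (h2 : 0 ≤ a2) (h3 : 0 ≤ a3)
    (h4 : 0 ≤ a4) (k1 : 0 ≤ b0) (k2 : 0 ≤ b2) (k3 : 0 ≤ b3) (k4 : 0 ≤ b4)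
    (c1 : aa * b0 ≤ (a2+a3+a4)*(b2+b3+b4))
    (c2 : a2 * b2 ≤ (aa+a3+a4)*(b0+b3+b4))
    (c3 : a3 * b3 ≤ (a2+aa+a4)*(b2+b0+b4))
    (c4 : a4 * b4 ≤ (a2+a3+aa)*(b2+b3+b0)) :
    |(b0+b2+b3+b4)*(a2+aa) - (aa+a2+a3+a4)*(b3+b4)|
    + |(b0+b2+b3+b4)*(a3+aa) - (aa+a2+a3+a4)*(b2+b4)|
    + |(b0+b2+b3+b4)*(a4+aa) - (aa+a2+a3+a4)*(b2+b3)| ≤ (aa+a2+a3+a4)*(b0+b2+b3+b4) := by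
  have q1 : ∀ x y : ℝ, 0 ≤ x → 0 ≤ y → 0 ≤ x * y := fun x y => mul_nonneg
  have := q1 _ _ h1 k1; have := q1 _ _ h1 k2; have := q1 _ _ h1 k3; have := q1 _ _ h1 k4
  have := q1 _ _ h2 k1; have := q1 _ _ h2 k2; have := q1 _ _ h2 k3; have := q1 _ _ h2 k4
  have := q1 _ _ h3 k1; have := q1 _ _ h3 k2; have := q1 _ _ h3 k3; have := q1 _ _ h3 k4
  have := q1 _ _ h4 k1; have := q1 _ _ h4 k2; have := q1 _ _ h4 k3; have := q1 _ _ h4 k4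
  rcases abs_cases ((b0+b2+b3+b4)*(a2+aa) - (aa+a2+a3+a4)*(b3+b4)) with ⟨e1, _⟩ | ⟨e1, _⟩ <;>
  rcases abs_cases ((b0+b2+b3+b4)*(a3+aa) - (aa+a2+a3+a4)*(b2+b4)) with ⟨e2, _⟩ | ⟨e2, _⟩ <;>
  rcases abs_cases ((b0+b2+b3+b4)*(a4+aa) - (aa+a2+a3+a4)*(b2+b3)) with ⟨e3, _⟩ | ⟨e3, _⟩ <;>
  rw [e1, e2, e3] <;> linarith

lemma sqrt_cs (a b a1 b1 a2 b2 a3 b3 : ℝ) (ha : 0 ≤ a) (hb : 0 ≤ b) (ha1 : 0 ≤ a1)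
    (hb1 : 0 ≤ b1) (ha2 : 0 ≤ a2) (hb2 : 0 ≤ b2) (ha3 : 0 ≤ a3) (hb3 : 0 ≤ b3)
    (h : √(a*b) ≤ √(a1*b1) + √(a2*b2) + √(a3*b3)) :
    a * b ≤ (a1+a2+a3)*(b1+b2+b3) := by
  rw [Real.sqrt_mul ha1, Real.sqrt_mul ha2, Real.sqrt_mul ha3] at h
  obtain ⟨x1, x2, x3⟩ := And.intro (Real.sq_sqrt ha1) (And.intro (Real.sq_sqrt ha2) (Real.sq_sqrt ha3))
  obtain ⟨y1, y2, y3⟩ := And.intro (Real.sq_sqrt hb1) (And.intro (Real.sq_sqrt hb2) (Real.sq_sqrt hb3))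
  have hab : a * b = √(a*b)^2 := (Real.sq_sqrt (mul_nonneg ha hb)).symm
  have h0 := Real.sqrt_nonneg (a*b)
  rw [hab]
  calc √(a*b)^2 ≤ (√a1 * √b1 + √a2 * √b2 + √a3 * √b3)^2 := by gcongr
    _ ≤ (√a1^2+√a2^2+√a3^2)*(√b1^2+√b2^2+√b3^2) := by
      nlinarith [sq_nonneg (√a1*√b2-√a2*√b1), sq_nonneg (√a1*√b3-√a3*√b1), sq_nonneg (√a2*√b3-√a3*√b2)]
    _ = _ := by rw [x1,x2,x3,y1,y2,y3]

/-- The quadrilateral condition on the four geometric means. -/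
def QC (α β γ δ : ℝ) : Prop :=
  α ≤ β + γ + δ ∧ β ≤ α + γ + δ ∧ γ ≤ α + β + δ ∧ δ ≤ α + β + γ

def Cond (p : P4 → ℝ) : Prop :=
  QC (√(p ![0,0,0,0] * p ![1,1,1,1])) (√(p ![1,1,0,0] * p ![0,0,1,1]))
    (√(p ![1,0,1,0] * p ![0,1,0,1])) (√(p ![1,0,0,1] * p ![0,1,1,0]))

lemma quad_form (s1 s2 s3 s4 c12 c13 c14 c23 c24 c34 d1 d2 d3 d4 : ℝ)
    (r1 : |c12| + |c13| + |c14| ≤ s1) (r2 : |c12| + |c23| + |c24| ≤ s2)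
    (r3 : |c13| + |c23| + |c34| ≤ s3) (r4 : |c14| + |c24| + |c34| ≤ s4) :
    2 * (d1*d2*c12 + d1*d3*c13 + d1*d4*c14 + d2*d3*c23 + d2*d4*c24 + d3*d4*c34) ≤
     d1^2*s1 + d2^2*s2 + d3^2*s3 + d4^2*s4 := by
  have key : ∀ x y c : ℝ, 2 * (x*y*c) ≤ (x^2+y^2)*|c| := by
    intro x y c
    rcases abs_cases c with ⟨e, h⟩ | ⟨e, h⟩ <;> rw [e] <;>
      nlinarith [mul_nonneg (sq_nonneg (x-y)) (abs_nonneg c), mul_nonneg (sq_nonneg (x+y)) (abs_nonneg c)]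
  have := key d1 d2 c12; have := key d1 d3 c13; have := key d1 d4 c14
  have := key d2 d3 c23; have := key d2 d4 c24; have := key d3 d4 c34
  have := mul_le_mul_of_nonneg_left r1 (sq_nonneg d1)
  have := mul_le_mul_of_nonneg_left r2 (sq_nonneg d2)
  have := mul_le_mul_of_nonneg_left r3 (sq_nonneg d3)
  have := mul_le_mul_of_nonneg_left r4 (sq_nonneg d4)
  linarith

lemma var8 (A B C C' D D' F F' : ℝ) (hA : 0 ≤ A) (hB : 0 ≤ B) (hC : 0 ≤ C) (hC' : 0 ≤ C')
    (hD : 0 ≤ D) (hD' : 0 ≤ D') (hF : 0 ≤ F) (hF' : 0 ≤ F')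
    (h : QC (√(A*B)) (√(C*C')) (√(D*D')) (√(F*F'))) (d1 d2 d3 d4 : ℝ) :
    (A+B+C+C'+D+D'+F+F') * (B*(d1+d2+d3+d4)^2 + C*(d1+d2)^2 + C'*(d3+d4)^2 + D*(d1+d3)^2
       + D'*(d2+d4)^2 + F*(d1+d4)^2 + F'*(d2+d3)^2)
      - (B*(d1+d2+d3+d4) + C*(d1+d2) + C'*(d3+d4) + D*(d1+d3)
       + D'*(d2+d4) + F*(d1+d4) + F'*(d2+d3))^2 ≤
    2 * (d1^2*((B+C+D+F)*(A+C'+D'+F')) + d2^2*((B+C+D'+F')*(A+C'+D+F))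
      + d3^2*((B+C'+D+F')*(A+C+D'+F)) + d4^2*((B+C'+D'+F)*(A+C+D+F'))) := by
  obtain ⟨h1, h2, h3, h4⟩ := h
  have sc : ∀ x y : ℝ, √(x*y) = √(y*x) := fun x y => by rw [mul_comm]
  have r1 := row_bound B C D F A C' D' F' hB hC hD hF hA hC' hD' hF'
    (sqrt_cs _ _ _ _ _ _ _ _ hB hA hC hC' hD hD' hF hF' (by rw [sc B A]; linarith))
    (sqrt_cs _ _ _ _ _ _ _ _ hC hC' hB hA hD hD' hF hF' (by rw [sc B A]; linarith))
    (sqrt_cs _ _ _ _ _ _ _ _ hD hD' hC hC' hB hA hF hF' (by rw [sc B A]; linarith))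
    (sqrt_cs _ _ _ _ _ _ _ _ hF hF' hC hC' hD hD' hB hA (by rw [sc B A]; linarith))
  have r2 := row_bound B C F' D' A C' F D hB hC hF' hD' hA hC' hF hD
    (sqrt_cs _ _ _ _ _ _ _ _ hB hA hC hC' hF' hF hD' hD (by rw [sc B A, sc F' F, sc D' D]; linarith))
    (sqrt_cs _ _ _ _ _ _ _ _ hC hC' hB hA hF' hF hD' hD (by rw [sc B A, sc F' F, sc D' D]; linarith))
    (sqrt_cs _ _ _ _ _ _ _ _ hF' hF hC hC' hB hA hD' hD (by rw [sc B A, sc F' F, sc D' D]; linarith))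
    (sqrt_cs _ _ _ _ _ _ _ _ hD' hD hC hC' hF' hF hB hA (by rw [sc B A, sc F' F, sc D' D]; linarith))
  have r3 := row_bound B D F' C' A D' F C hB hD hF' hC' hA hD' hF hC
    (sqrt_cs _ _ _ _ _ _ _ _ hB hA hD hD' hF' hF hC' hC (by rw [sc B A, sc F' F, sc C' C]; linarith))
    (sqrt_cs _ _ _ _ _ _ _ _ hD hD' hB hA hF' hF hC' hC (by rw [sc B A, sc F' F, sc C' C]; linarith))
    (sqrt_cs _ _ _ _ _ _ _ _ hF' hF hD hD' hB hA hC' hC (by rw [sc B A, sc F' F, sc C' C]; linarith))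
    (sqrt_cs _ _ _ _ _ _ _ _ hC' hC hD hD' hF' hF hB hA (by rw [sc B A, sc F' F, sc C' C]; linarith))
  have r4 := row_bound B F D' C' A F' D C hB hF hD' hC' hA hF' hD hC
    (sqrt_cs _ _ _ _ _ _ _ _ hB hA hF hF' hD' hD hC' hC (by rw [sc B A, sc D' D, sc C' C]; linarith))
    (sqrt_cs _ _ _ _ _ _ _ _ hF hF' hB hA hD' hD hC' hC (by rw [sc B A, sc D' D, sc C' C]; linarith))
    (sqrt_cs _ _ _ _ _ _ _ _ hD' hD hF hF' hB hA hC' hC (by rw [sc B A, sc D' D, sc C' C]; linarith))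
    (sqrt_cs _ _ _ _ _ _ _ _ hC' hC hF hF' hD' hD hB hA (by rw [sc B A, sc D' D, sc C' C]; linarith))
  have := quad_form ((B+C+D+F)*(A+C'+D'+F')) ((B+C+D'+F')*(A+C'+D+F))
    ((B+C'+D+F')*(A+C+D'+F)) ((B+C'+D'+F)*(A+C+D+F'))
    ((A+B+C+C'+D+D'+F+F')*(B+C) - (B+C+D+F)*(B+C+D'+F'))
    ((A+B+C+C'+D+D'+F+F')*(B+D) - (B+C+D+F)*(B+C'+D+F'))
    ((A+B+C+C'+D+D'+F+F')*(B+F) - (B+C+D+F)*(B+C'+D'+F))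
    ((A+B+C+C'+D+D'+F+F')*(B+F') - (B+C+D'+F')*(B+C'+D+F'))
    ((A+B+C+C'+D+D'+F+F')*(B+D') - (B+C+D'+F')*(B+C'+D'+F))
    ((A+B+C+C'+D+D'+F+F')*(B+C') - (B+C'+D+F')*(B+C'+D'+F)) d1 d2 d3 d4
    (by convert r1 using 1 <;> ring_nf) (by convert r2 using 1 <;> ring_nf)
    (by convert r3 using 1 <;> ring_nf) (by convert r4 using 1 <;> ring_nf)
  linarith

lemma varP4 (p : P4 → ℝ) (hp : ∀ e, 0 ≤ p e) (ho : ∀ e : P4, ∑ j, e j ≠ 0 → p e = 0)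
    (h : Cond p) (y : Fin 4 → ZMod 2 → ℝ) :
    (∑ e, p e) * (∑ e, p e * (∑ j, y j (e j))^2) - (∑ e, p e * (∑ j, y j (e j)))^2 ≤
      2 * ((∑ e, p e) * ∑ e, p e * ∑ j, (y j (e j))^2) := by
  rw [sumP4 p ho, sumP4 (fun e => p e * (∑ j, y j (e j))^2) (fun e he => by simp [ho e he]),
    sumP4 (fun e => p e * (∑ j, y j (e j))) (fun e he => by simp [ho e he]),
    sumP4 (fun e => p e * (∑ j, y j (e j)^2)) (fun e he => by simp [ho e he])]
  simp only [Fin.sum_univ_four, Matrix.cons_val]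
  have := var8 _ _ _ _ _ _ _ _ (hp ![0,0,0,0]) (hp ![1,1,1,1]) (hp ![1,1,0,0]) (hp ![0,0,1,1])
    (hp ![1,0,1,0]) (hp ![0,1,0,1]) (hp ![1,0,0,1]) (hp ![0,1,1,0]) h
    (y 0 1 - y 0 0) (y 1 1 - y 1 0) (y 2 1 - y 2 0) (y 3 1 - y 3 0)
  generalize p ![0,0,0,0] = A at *
  generalize p ![1,1,1,1] = B at *
  generalize p ![1,1,0,0] = C at *
  generalize p ![0,0,1,1] = C' at *
  generalize p ![1,0,1,0] = D at *
  generalize p ![0,1,0,1] = D' at *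
  generalize p ![1,0,0,1] = F at *
  generalize p ![0,1,1,0] = F' at *
  generalize y 0 1 = y01 at *
  generalize y 0 0 = y00 at *
  generalize y 1 1 = y11 at *
  generalize y 1 0 = y10 at *
  generalize y 2 1 = y21 at *
  generalize y 2 0 = y20 at *
  generalize y 3 1 = y31 at *
  generalize y 3 0 = y30 at *
  have s1 := sq_nonneg ((A+C'+D'+F')*y00 + (B+C+D+F)*y01)
  have s2 := sq_nonneg ((A+C'+D+F)*y10 + (B+C+D'+F')*y11)
  have s3 := sq_nonneg ((A+C+D'+F)*y20 + (B+C'+D+F')*y21)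
  have s4 := sq_nonneg ((A+C+D+F')*y30 + (B+C'+D'+F)*y31)
  linarith


lemma cond_tilt (p : P4 → ℝ) (x : Fin 4 → ZMod 2 → ℝ) (hx : ∀ j b, 0 ≤ x j b) (h : Cond p) :
    Cond (fun e => p e * ∏ j, x j (e j)) := by
  have hP : (0:ℝ) ≤ x 0 0 * x 1 0 * x 2 0 * x 3 0 * (x 0 1 * x 1 1 * x 2 1 * x 3 1) := by
    have := hx 0 0; have := hx 1 0; have := hx 2 0; have := hx 3 0
    have := hx 0 1; have := hx 1 1; have := hx 2 1; have := hx 3 1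
    positivity
  set P : ℝ := x 0 0 * x 1 0 * x 2 0 * x 3 0 * (x 0 1 * x 1 1 * x 2 1 * x 3 1) with hPdef
  have hs := Real.sqrt_nonneg P
  unfold Cond QC at *
  obtain ⟨h1, h2, h3, h4⟩ := h
  simp only [Fin.prod_univ_four, Matrix.cons_val]
  have e : ∀ c a b : ℝ, c = P * (a * b) → √c = √P * √(a*b) := by
    intro c a b hc; rw [hc, Real.sqrt_mul hP]
  have E1 : √(p ![0,0,0,0] * (x 0 0 * x 1 0 * x 2 0 * x 3 0) *
      (p ![1,1,1,1] * (x 0 1 * x 1 1 * x 2 1 * x 3 1))) = _ :=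
    e _ (p ![0,0,0,0]) (p ![1,1,1,1]) (by rw [hPdef]; ring)
  have E2 : √(p ![1,1,0,0] * (x 0 1 * x 1 1 * x 2 0 * x 3 0) *
      (p ![0,0,1,1] * (x 0 0 * x 1 0 * x 2 1 * x 3 1))) = _ :=
    e _ (p ![1,1,0,0]) (p ![0,0,1,1]) (by rw [hPdef]; ring)
  have E3 : √(p ![1,0,1,0] * (x 0 1 * x 1 0 * x 2 1 * x 3 0) *
      (p ![0,1,0,1] * (x 0 0 * x 1 1 * x 2 0 * x 3 1))) = _ :=
    e _ (p ![1,0,1,0]) (p ![0,1,0,1]) (by rw [hPdef]; ring)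
  have E4 : √(p ![1,0,0,1] * (x 0 1 * x 1 0 * x 2 0 * x 3 1) *
      (p ![0,1,1,0] * (x 0 0 * x 1 1 * x 2 1 * x 3 0))) = _ :=
    e _ (p ![1,0,0,1]) (p ![0,1,1,0]) (by rw [hPdef]; ring)
  rw [E1, E2, E3, E4]
  simp only [← mul_add]
  exact ⟨mul_le_mul_of_nonneg_left h1 hs, mul_le_mul_of_nonneg_left h2 hs,
    mul_le_mul_of_nonneg_left h3 hs, mul_le_mul_of_nonneg_left h4 hs⟩

lemma path_ineq (p : P4 → ℝ) (hp : ∀ e, 0 ≤ p e) (ho : ∀ e : P4, ∑ j, e j ≠ 0 → p e = 0)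
    (h : Cond p) (hZ : 0 < ∑ e, p e) (v : Fin 4 → ZMod 2 → ℝ) (hv : ∀ j b, 0 ≤ v j b)
    (hn : ∀ j, ∑ e, p e * v j (e j) = ∑ e, p e) :
    ∑ e, p e * ∏ j, √(v j (e j)) ≤ ∑ e, p e := by
  set U : Fin 4 → ZMod 2 → ℝ → ℝ := fun j b t => 1 - t + t * v j b with hU
  set y : Fin 4 → ZMod 2 → ℝ → ℝ := fun j b t => (v j b - 1) / U j b t with hy
  set q : P4 → ℝ → ℝ := fun e t => p e * ∏ j, √(U j (e j) t) with hq
  set K : ℝ → ℝ := fun t => ∑ e, q e t with hK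
  set Lf : ℝ → ℝ := fun t => ∑ e, q e t * ∑ j, y j (e j) t with hL
  have Upos : ∀ j b t, t ∈ Set.Ico (0:ℝ) 1 → 0 < U j b t := by
    intro j b t ht
    have := mul_nonneg ht.1 (hv j b)
    simp only [hU]; linarith [ht.2]
  have dU : ∀ j b t, HasDerivAt (U j b) (v j b - 1) t := by
    intro j b t
    have h1 := ((hasDerivAt_const t (1:ℝ)).sub (hasDerivAt_id t)).add
      ((hasDerivAt_id t).mul_const (v j b))
    refine HasDerivAt.congr_deriv (f := U j b) h1 ?_
    ring
  have dS : ∀ j b t, t ∈ Set.Ico (0:ℝ) 1 →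
      HasDerivAt (fun t => √(U j b t)) (√(U j b t) * (y j b t / 2)) t := by
    intro j b t ht
    have h0 := Upos j b t ht
    convert (dU j b t).sqrt h0.ne' using 1
    simp only [hy]
    have hs : √(U j b t) ≠ 0 := (Real.sqrt_pos.2 h0).ne'
    have hs2 : U j b t = √(U j b t)^2 := (Real.sq_sqrt h0.le).symm
    rw [div_div, mul_div_assoc', div_eq_div_iff (by positivity) (by positivity)]
    nth_rewrite 3 [hs2]
    ring
  have dy : ∀ j b t, t ∈ Set.Ico (0:ℝ) 1 → HasDerivAt (y j b) (-(y j b t)^2) t := by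
    intro j b t ht
    have h0 := Upos j b t ht
    refine HasDerivAt.congr_deriv (f := y j b)
      ((hasDerivAt_const t (v j b - 1)).div (dU j b t) h0.ne') ?_
    simp only [hy]
    rw [div_pow]
    ring
  have dq : ∀ e t, t ∈ Set.Ico (0:ℝ) 1 →
      HasDerivAt (q e) (q e t * (∑ j, y j (e j) t) / 2) t := by
    intro e t ht
    have := ((((dS 0 (e 0) t ht).mul (dS 1 (e 1) t ht)).mul (dS 2 (e 2) t ht)).mul
      (dS 3 (e 3) t ht)).const_mul (p e)
    simp only [hq, Fin.prod_univ_four, Fin.sum_univ_four]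
    refine HasDerivAt.congr_deriv this ?_
    simp only [Pi.mul_apply]
    ring
  have dK : ∀ t, t ∈ Set.Ico (0:ℝ) 1 → HasDerivAt K (Lf t / 2) t := by
    intro t ht
    have := HasDerivAt.fun_sum (u := Finset.univ) (fun e (_ : e ∈ Finset.univ) => dq e t ht)
    refine HasDerivAt.congr_deriv (f := K) this ?_
    rw [hL, Finset.sum_div]
  have dL : ∀ t, t ∈ Set.Ico (0:ℝ) 1 → HasDerivAt Lf
      ((∑ e, q e t * (∑ j, y j (e j) t)^2) / 2 - ∑ e, q e t * ∑ j, (y j (e j) t)^2) t := by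
    intro t ht
    have := HasDerivAt.fun_sum (u := Finset.univ) (fun e (_ : e ∈ Finset.univ) => (dq e t ht).mul
      (HasDerivAt.fun_sum (u := Finset.univ) (fun j (_ : j ∈ Finset.univ) => dy j (e j) t ht)))
    refine HasDerivAt.congr_deriv (f := Lf) this ?_
    rw [Finset.sum_div, ← Finset.sum_sub_distrib]
    refine Finset.sum_congr rfl fun e _ => ?_
    rw [Finset.sum_neg_distrib]
    ring
  have q0 : ∀ e t, 0 ≤ q e t := fun e t =>
    mul_nonneg (hp e) (Finset.prod_nonneg fun _ _ => Real.sqrt_nonneg _)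
  have Kpos : ∀ t, t ∈ Set.Ico (0:ℝ) 1 → 0 < K t := by
    intro t ht
    obtain ⟨e, _, he⟩ := Finset.exists_lt_of_sum_lt (s := Finset.univ) (f := fun _ : P4 => (0:ℝ))
      (g := p) (by simpa using hZ)
    refine Finset.sum_pos' (fun e _ => q0 e t) ⟨e, Finset.mem_univ _, ?_⟩
    exact mul_pos he (Finset.prod_pos fun j _ => Real.sqrt_pos.2 (Upos _ _ t ht))
  have K0 : K 0 = ∑ e, p e := by simp [hK, hq, hU]
  have K1 : K 1 = ∑ e, p e * ∏ j, √(v j (e j)) := by simp [hK, hq, hU]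
  have L0 : Lf 0 = 0 := by
    simp only [hL, hq, hU, hy]
    simp only [sub_zero, zero_mul, add_zero, Real.sqrt_one, Finset.prod_const_one, mul_one, div_one]
    simp only [Finset.mul_sum]
    rw [Finset.sum_comm]
    refine Finset.sum_eq_zero fun j _ => ?_
    simp only [mul_sub, mul_one, Finset.sum_sub_distrib, hn j, sub_self]
  have dA : ∀ t, t ∈ Set.Ico (0:ℝ) 1 → ∃ d ≤ 0, HasDerivAt (fun t => Lf t / K t) d t := by
    intro t ht
    refine ⟨_, ?_, (dL t ht).div (dK t ht) (Kpos t ht).ne'⟩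
    have hc : Cond (fun e => q e t) :=
      cond_tilt p (fun j b => √(U j b t)) (fun _ _ => Real.sqrt_nonneg _) h
    have hvar := varP4 (fun e => q e t) (fun e => q0 e t)
      (fun e he => by simp [hq, ho e he]) hc (fun j b => y j b t)
    refine div_nonpos_of_nonpos_of_nonneg ?_ (sq_nonneg _)
    simp only [hK, hL] at *
    nlinarith
  have anti : AntitoneOn (fun t => Lf t / K t) (Set.Ico 0 1) := by
    apply antitoneOn_of_deriv_nonpos (convex_Ico 0 1)
    · intro t ht
      obtain ⟨d, _, hd⟩ := dA t ht
      exact hd.continuousAt.continuousWithinAt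
    · intro t ht
      obtain ⟨d, _, hd⟩ := dA t (interior_subset ht)
      exact hd.differentiableAt.differentiableWithinAt
    · intro t ht
      obtain ⟨d, hd0, hd⟩ := dA t (interior_subset ht)
      rw [hd.deriv]; exact hd0
  have Lneg : ∀ t, t ∈ Set.Ico (0:ℝ) 1 → Lf t ≤ 0 := by
    intro t ht
    have := anti ⟨le_refl _, one_pos⟩ ht ht.1
    simp only [L0, zero_div] at this
    by_contra hc
    push Not at hc
    exact absurd this (not_le.2 (div_pos hc (Kpos t ht)))
  have Kcont : Continuous K := by
    simp only [hK, hq, hU]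
    fun_prop
  have antiK : AntitoneOn K (Set.Icc 0 1) := by
    apply antitoneOn_of_deriv_nonpos (convex_Icc 0 1) Kcont.continuousOn
    · intro t ht
      rw [interior_Icc] at ht
      exact (dK t ⟨ht.1.le, ht.2⟩).differentiableAt.differentiableWithinAt
    · intro t ht
      rw [interior_Icc] at ht
      rw [(dK t ⟨ht.1.le, ht.2⟩).deriv]
      linarith [Lneg t ⟨ht.1.le, ht.2⟩]
  have := antiK (Set.left_mem_Icc.2 zero_le_one) (Set.right_mem_Icc.2 zero_le_one) zero_le_one
  rwa [K0, K1] at this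

/-- Four-function inequality, normalised form. -/
lemma four_ineq (p : P4 → ℝ) (hp : ∀ e, 0 ≤ p e) (ho : ∀ e : P4, ∑ j, e j ≠ 0 → p e = 0)
    (h : Cond p) (u : Fin 4 → ZMod 2 → ℝ) (hu : ∀ j b, 0 ≤ u j b) :
    ∑ e, p e * ∏ j, u j (e j) ≤
      (∑ e, p e) * ∏ j, √((∑ e, p e * u j (e j)^2) / ∑ e, p e) := by
  have hZ0 : 0 ≤ ∑ e, p e := Finset.sum_nonneg fun e _ => hp e
  have hn0 : ∀ j, 0 ≤ ∑ e, p e * u j (e j)^2 := fun j =>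
    Finset.sum_nonneg fun e _ => mul_nonneg (hp e) (sq_nonneg _)
  have rhs0 : 0 ≤ (∑ e, p e) * ∏ j, √((∑ e, p e * u j (e j)^2) / ∑ e, p e) :=
    mul_nonneg hZ0 (Finset.prod_nonneg fun _ _ => Real.sqrt_nonneg _)
  by_cases hdeg : ∀ j, 0 < ∑ e, p e * u j (e j)^2
  swap
  · push Not at hdeg
    obtain ⟨j, hj⟩ := hdeg
    have hz := (Finset.sum_eq_zero_iff_of_nonneg
      (fun e _ => mul_nonneg (hp e) (sq_nonneg (u j (e j))))).1 (le_antisymm hj (hn0 j))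
    refine le_trans (le_of_eq ?_) rhs0
    refine Finset.sum_eq_zero fun e he => ?_
    rcases mul_eq_zero.1 (hz e he) with h0 | h0
    · simp [h0]
    · rw [Finset.prod_eq_zero (Finset.mem_univ j) (pow_eq_zero_iff (two_ne_zero) |>.1 h0), mul_zero]
  have hZ : 0 < ∑ e, p e := by
    rcases hZ0.lt_or_eq with h1 | h1
    · exact h1
    · have hz := (Finset.sum_eq_zero_iff_of_nonneg (fun e _ => hp e)).1 h1.symm
      have := hdeg 0
      rw [Finset.sum_eq_zero (fun e he => by rw [hz e he, zero_mul])] at this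
      exact absurd this (lt_irrefl _)
  set Z := ∑ e, p e with hZd
  set n : Fin 4 → ℝ := fun j => (∑ e, p e * u j (e j)^2) / Z with hnd
  have npos : ∀ j, 0 < n j := fun j => div_pos (hdeg j) hZ
  have key := path_ineq p hp ho h hZ (fun j b => u j b^2 / n j)
    (fun j b => div_nonneg (sq_nonneg _) (npos j).le) (by
      intro j
      simp only [mul_div_assoc']
      rw [← Finset.sum_div, div_eq_iff (npos j).ne']
      simp only [hnd]
      field_simp
      try rw [hZd])
  have e1 : ∀ e : P4, ∏ j, √(u j (e j)^2 / n j) = (∏ j, u j (e j)) / ∏ j, √(n j) := by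
    intro e
    rw [← Finset.prod_div_distrib]
    refine Finset.prod_congr rfl fun j _ => ?_
    rw [Real.sqrt_div (sq_nonneg _), Real.sqrt_sq (hu _ _)]
  simp only [e1, mul_div_assoc'] at key
  rw [← Finset.sum_div, div_le_iff₀ (Finset.prod_pos fun j _ => Real.sqrt_pos.2 (npos j))] at key
  exact key


/-- closed half-plane cone in `ℂ²` -/
def HH (v : ZMod 2 → ℂ) : Prop :=
  (v 0 ≠ 0 ∨ v 1 ≠ 0) ∧ 0 ≤ (v 0 * (starRingEnd ℂ) (v 1)).re

/-- Hurwitz polynomials of exact degree `M` -/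
def GoodP (M : ℕ) (P : Polynomial ℂ) : Prop :=
  P.natDegree = M ∧ ∀ z : ℂ, 0 ≤ z.re → P.eval z ≠ 0

lemma GoodP.ne_zero {M : ℕ} {P : Polynomial ℂ} (h : GoodP M P) : P ≠ 0 := by
  rintro rfl
  exact h.2 0 le_rfl (by simp)

lemma GoodP.derivative {M : ℕ} {P : Polynomial ℂ} (h : GoodP (M+1) P) :
    GoodP M (Polynomial.derivative P) := by
  have hc : (Polynomial.derivative P).coeff M ≠ 0 := by
    rw [Polynomial.coeff_derivative, ← h.1]
    refine mul_ne_zero ?_ (by exact_mod_cast Nat.succ_ne_zero M)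
    exact Polynomial.leadingCoeff_ne_zero.2 h.ne_zero
  have hd0 : Polynomial.derivative P ≠ 0 := by
    intro h0; rw [h0] at hc; simp at hc
  refine ⟨le_antisymm ?_ (Polynomial.le_natDegree_of_ne_zero hc), ?_⟩
  · have := Polynomial.natDegree_derivative_le P
    rw [h.1] at this; simpa using this
  · intro z hz h0
    have hpos : 0 < P.degree := by
      rw [← Polynomial.natDegree_pos_iff_degree_pos, h.1]; omega
    have hm : z ∈ (Polynomial.derivative P).rootSet ℂ := by
      rw [Polynomial.mem_rootSet]
      exact ⟨hd0, by simpa using h0⟩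
    have h1 := Polynomial.rootSet_derivative_subset_convexHull_rootSet hpos hm
    have h2 : (convexHull ℝ) (P.rootSet ℂ) ⊆ {w : ℂ | w.re < 0} := by
      refine convexHull_min ?_ (convex_halfSpace_re_lt 0)
      intro w hw
      rw [Polynomial.mem_rootSet] at hw
      by_contra hc'
      simp only [Set.mem_ofPred_eq, not_lt] at hc'
      exact h.2 w hc' (by simpa using hw.2)
    have := h2 h1
    simp only [Set.mem_ofPred_eq] at this
    linarith

lemma GoodP.iterate {M : ℕ} (r : ℕ) : ∀ {P : Polynomial ℂ}, GoodP (M+r) P →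
    GoodP M (Polynomial.derivative^[r] P) := by
  induction r with
  | zero => intro P h; simpa using h
  | succ r ih =>
    intro P h
    rw [Function.iterate_succ_apply]
    exact ih (GoodP.derivative h)

lemma GoodP.rev {M : ℕ} {P : Polynomial ℂ} (h : GoodP M P) : GoodP M P.reverse := by
  have h0 : P.coeff 0 ≠ 0 := by
    have := h.2 0 le_rfl
    rwa [← Polynomial.coeff_zero_eq_eval_zero] at this
  constructor
  · rw [Polynomial.reverse_natDegree, h.1, Polynomial.natTrailingDegree_eq_zero.2 (Or.inr h0)]
    simp
  · intro z hz hz0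
    by_cases hzz : z = 0
    · subst hzz
      rw [← Polynomial.coeff_zero_eq_eval_zero, Polynomial.coeff_zero_reverse] at hz0
      exact Polynomial.leadingCoeff_ne_zero.2 h.ne_zero hz0
    · have hi : z⁻¹ ≠ 0 := inv_ne_zero hzz
      let _ : Invertible (z⁻¹) := invertibleOfNonzero hi
      have := (Polynomial.eval₂_reverse_eq_zero_iff (RingHom.id ℂ) (z⁻¹) P)
      rw [invOf_eq_inv, inv_inv] at this
      refine h.2 (z⁻¹) ?_ (this.1 hz0)
      rw [Complex.inv_re]
      exact div_nonneg hz (Complex.normSq_nonneg _)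

noncomputable def phi (m k : ℕ) (v : ZMod 2 → ℂ) (d : ℕ) : ℂ :=
  if d = k then v 0 / (m.choose k : ℂ) else if d + 1 = k then v 1 / (m.choose d : ℂ) else 0

lemma lemmaU {ι : Type*} [Fintype ι] (m k : ℕ) (s : ι → ℂ) (d : ι → ℕ) (hd : ∀ a, d a ≤ m)
    (hk1 : 1 ≤ k) (hkm : k ≤ m)
    (h : ∀ v, HH v → ∑ a, s a * (v 1 ^ d a * v 0 ^ (m - d a)) ≠ 0) (v : ZMod 2 → ℂ) (hv : HH v) :
    ∑ a, s a * phi m k v (d a) ≠ 0 := by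
  classical
  set P : Polynomial ℂ := ∑ a, Polynomial.C (s a) * Polynomial.X ^ d a with hP
  have hPc : ∀ i, P.coeff i = ∑ a, if d a = i then s a else 0 := by
    intro i
    rw [hP, Polynomial.finsetSum_coeff]
    refine Finset.sum_congr rfl fun a _ => ?_
    rw [Polynomial.coeff_C_mul_X_pow]
    simp only [eq_comm]
  have hgood : GoodP m P := by
    constructor
    · apply le_antisymm
      · rw [hP]
        refine Polynomial.natDegree_sum_le_of_forall_le _ _ fun a _ => ?_
        exact (Polynomial.natDegree_C_mul_X_pow_le _ _).trans (hd a)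
      · apply Polynomial.le_natDegree_of_ne_zero
        have := h (fun b => if b = 0 then 0 else 1) (by simp [HH])
        rw [hPc]
        intro h0
        apply this
        refine Eq.trans ?_ h0
        refine Finset.sum_congr rfl fun a _ => ?_
        have := hd a
        by_cases e : d a = m
        · simp [e]
        · have : m - d a ≠ 0 := by omega
          simp [e, this]
    · intro z hz
      have := h (fun b => if b = 0 then 1 else z) (by simp [HH, hz])
      rw [hP, Polynomial.eval_finsetSum]
      simpa using this
  obtain ⟨k, rfl⟩ : ∃ k', k = k' + 1 := ⟨k - 1, by omega⟩
  obtain ⟨l, rfl⟩ : ∃ l, m = l + 1 + k := ⟨m - 1 - k, by omega⟩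
  set Q := Polynomial.derivative^[k] P with hQ
  have gQ : GoodP (l+1) Q := GoodP.iterate k hgood
  set R := Polynomial.derivative^[l] Q.reverse with hR
  have gR : GoodP 1 R := GoodP.iterate l (by rw [add_comm 1 l]; exact gQ.rev)
  have c0 : R.coeff 0 = (l.factorial * (k+1).factorial : ℂ) * P.coeff (k+1) := by
    rw [hR, Polynomial.coeff_iterate_derivative, Polynomial.coeff_reverse, gQ.1, hQ,
      Polynomial.coeff_iterate_derivative]
    rw [Polynomial.revAt_le (by omega)]
    have : l + 1 - (0 + l) = 1 := by omega
    rw [this, zero_add, Nat.descFactorial_self, add_comm 1 k]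
    have : (k+1).descFactorial k = (k+1).factorial := by
      rw [Nat.descFactorial_eq_div (by omega)]; simp
    rw [this]
    simp only [nsmul_eq_mul]
    ring
  have c1 : R.coeff 1 = ((l+1).factorial * k.factorial : ℂ) * P.coeff k := by
    rw [hR, Polynomial.coeff_iterate_derivative, Polynomial.coeff_reverse, gQ.1, hQ,
      Polynomial.coeff_iterate_derivative]
    rw [Polynomial.revAt_le (by omega)]
    have : l + 1 - (1 + l) = 0 := by omega
    rw [this, zero_add, Nat.descFactorial_self, add_comm 1 l]
    have : (l+1).descFactorial l = (l+1).factorial := by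
      rw [Nat.descFactorial_eq_div (by omega)]; simp
    rw [this]
    simp only [nsmul_eq_mul]
    ring
  have hRe : ∀ z, R.eval z = R.coeff 0 + R.coeff 1 * z := by
    intro z
    rw [Polynomial.eval_eq_sum_range, gR.1]
    simp [Finset.sum_range_succ]
  have hR1 : R.coeff 1 ≠ 0 := by
    have := Polynomial.leadingCoeff_ne_zero.2 gR.ne_zero
    rwa [Polynomial.leadingCoeff, gR.1] at this
  have b0 : ((l+1+k).factorial : ℂ) = (l+1+k).choose (k+1) * ((k+1).factorial * l.factorial) := by
    have := Nat.choose_mul_factorial_mul_factorial (n := l+1+k) (k := k+1) (by omega)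
    rw [show l + 1 + k - (k+1) = l by omega] at this
    rw [← this]; push_cast; ring
  have b1 : ((l+1+k).factorial : ℂ) = (l+1+k).choose k * (k.factorial * (l+1).factorial) := by
    have := Nat.choose_mul_factorial_mul_factorial (n := l+1+k) (k := k) (by omega)
    rw [show l + 1 + k - k = l + 1 by omega] at this
    rw [← this]; push_cast; ring
  have n0 : ((l+1+k).choose (k+1) : ℂ) ≠ 0 := by
    exact_mod_cast (Nat.choose_pos (by omega)).ne'
  have n1 : ((l+1+k).choose k : ℂ) ≠ 0 := by
    exact_mod_cast (Nat.choose_pos (by omega)).ne'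
  have sumeq : ((l+1+k).factorial : ℂ) * ∑ a, s a * phi (l+1+k) (k+1) v (d a)
      = R.coeff 0 * v 0 + R.coeff 1 * v 1 := by
    rw [c0, c1, hPc, hPc, Finset.mul_sum, Finset.mul_sum, Finset.mul_sum, Finset.sum_mul,
      Finset.sum_mul, ← Finset.sum_add_distrib]
    refine Finset.sum_congr rfl fun a _ => ?_
    unfold phi
    by_cases e1 : d a = k + 1
    · rw [if_pos e1, if_pos e1, if_neg (by omega), b0]
      field_simp
      ring
    · rw [if_neg e1, if_neg e1]
      by_cases e2 : d a = k
      · rw [if_pos (by omega), if_pos e2, e2, b1]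
        field_simp
        ring
      · rw [if_neg (by omega), if_neg e2]
        ring
  intro h0
  rw [h0, mul_zero] at sumeq
  by_cases hv0 : v 0 = 0
  · have hv1 : v 1 ≠ 0 := by
      rcases hv.1 with h | h
      · exact absurd hv0 h
      · exact h
    rw [hv0] at sumeq
    simp [hR1, hv1] at sumeq
  · refine gR.2 (v 1 / v 0) ?_ ?_
    · have := hv.2
      rw [Complex.div_re]
      simp only [Complex.mul_re, Complex.conj_re, Complex.conj_im] at this
      rw [← add_div]
      refine div_nonneg ?_ (Complex.normSq_nonneg _)
      linarith
    · rw [hRe]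
      field_simp
      linear_combination -sumeq


lemma GoodP.lower (M : ℕ) : ∀ {P : Polynomial ℂ}, GoodP M P → ∀ w : ℂ, 0 ≤ w.re →
    ‖P.leadingCoeff‖ * w.re ^ M ≤ ‖P.eval w‖ := by
  induction M with
  | zero =>
    intro P h w hw
    rw [Polynomial.eq_C_of_natDegree_eq_zero h.1]
    simp
  | succ M ih =>
    intro P h w hw
    obtain ⟨z, hz⟩ := IsAlgClosed.exists_root P (by
      have : 0 < P.degree := by
        rw [← Polynomial.natDegree_pos_iff_degree_pos, h.1]; omega
      exact this.ne')
    obtain ⟨Q, rfl⟩ := Polynomial.dvd_iff_isRoot.2 hz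
    have hQ0 : Q ≠ 0 := by
      rintro rfl
      exact h.ne_zero (by simp)
    have hzre : z.re < 0 := by
      by_contra hc
      push Not at hc
      exact h.2 z hc (by simp)
    have hQ : GoodP M Q := by
      constructor
      · have := h.1
        rw [Polynomial.natDegree_mul (Polynomial.X_sub_C_ne_zero z) hQ0,
          Polynomial.natDegree_X_sub_C] at this
        omega
      · intro y hy h0
        exact h.2 y hy (by simp [h0])
    have := ih hQ w hw
    rw [Polynomial.leadingCoeff_mul, Polynomial.leadingCoeff_X_sub_C, one_mul,
      Polynomial.eval_mul, norm_mul, pow_succ, ← mul_assoc, mul_comm]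
    refine mul_le_mul ?_ this (by positivity) (norm_nonneg _)
    have h1 := Complex.re_le_norm (w - z)
    simp only [Complex.sub_re] at h1
    simp only [Polynomial.eval_sub, Polynomial.eval_X, Polynomial.eval_C]
    linarith

lemma hurw4 (a0 a1 a2 a3 a4 : ℂ) (h4 : a4 ≠ 0)
    (h : ∀ w : ℂ, 0 ≤ w.re → a0 + a1*w + a2*w^2 + a3*w^3 + a4*w^4 ≠ 0) (w : ℂ) (hw : 0 ≤ w.re) :
    ‖a4‖ * w.re^4 ≤ ‖a0 + a1*w + a2*w^2 + a3*w^3 + a4*w^4‖ := by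
  set P : Polynomial ℂ := Polynomial.C a4 * Polynomial.X^4 + Polynomial.C a3 * Polynomial.X^3
    + Polynomial.C a2 * Polynomial.X^2 + Polynomial.C a1 * Polynomial.X + Polynomial.C a0 with hP
  have hd : P.natDegree = 4 := by
    rw [hP]; compute_degree!
  have hl : P.leadingCoeff = a4 := by
    rw [Polynomial.leadingCoeff, hd, hP]
    simp
  have he : ∀ w, P.eval w = a0 + a1*w + a2*w^2 + a3*w^3 + a4*w^4 := by
    intro w; rw [hP]; simp; ring
  have := GoodP.lower 4 (P := P) ⟨hd, fun z hz => by rw [he]; exact h z hz⟩ w hw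
  rwa [hl, he] at this

lemma sum16 {M : Type*} [AddCommMonoid M] (g : P4 → M) :
    ∑ e, g e = (g ![0,0,0,0]) + (g ![0,0,0,1] + g ![0,0,1,0] + g ![0,1,0,0] + g ![1,0,0,0])
      + (g ![1,1,0,0] + g ![0,0,1,1] + g ![1,0,1,0] + g ![0,1,0,1] + g ![1,0,0,1] + g ![0,1,1,0])
      + (g ![1,1,1,0] + g ![1,1,0,1] + g ![1,0,1,1] + g ![0,1,1,1]) + g ![1,1,1,1] := by
  have key : ∀ x y z t : ZMod 2, ∀ a : Fin 0 → ZMod 2,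
      (Fin.cons x (Fin.cons y (Fin.cons z (Fin.cons t a : Fin 1 → ZMod 2) : Fin 2 → ZMod 2)
        : Fin 3 → ZMod 2) : P4) = ![x,y,z,t] := by
    intro x y z t a
    have : a = ![] := Subsingleton.elim _ _
    subst this; rfl
  simp only [sumCons, sumZ, key, Finset.univ_unique, Finset.sum_singleton]
  abel

/-- no roots in the right half plane, biquadratic case -/
lemma biquad (A B C : ℝ) (hA : 0 < A) (hB : 0 ≤ B) (hC : 0 < C)
    (h : ∀ w : ℂ, 0 < w.re → (A:ℂ) + B*w^2 + C*w^4 ≠ 0) : 2 * √(A*C) ≤ B := by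
  by_contra hc
  push Not at hc
  set ρ := √(A/C) with hρ
  have hρ2 : ρ^2 = A/C := Real.sq_sqrt (by positivity)
  have hρ0 : 0 < ρ := Real.sqrt_pos.2 (by positivity)
  have e1 : √(A*C) = C * ρ := by
    rw [show A*C = (C*ρ)^2 by rw [mul_pow, hρ2]; field_simp]
    exact Real.sqrt_sq (by positivity)
  rw [e1] at hc
  have hA' : A = C * ρ^2 := by rw [hρ2]; field_simp
  obtain ⟨b, rfl⟩ : ∃ b, B = C * b := ⟨B/C, by field_simp⟩
  have hb : b < 2*ρ := by
    have : C * b < C * (2*ρ) := by linarith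
    exact lt_of_mul_lt_mul_left this hC.le
  have hb0 : 0 ≤ b := by
    by_contra h'; push Not at h'
    nlinarith
  set κ := √(2*ρ-b)
  set μ := √(2*ρ+b)
  have hκ : κ^2 = 2*ρ-b := Real.sq_sqrt (by linarith)
  have hμ : μ^2 = 2*ρ+b := Real.sq_sqrt (by linarith)
  have hκ0 : 0 < κ := Real.sqrt_pos.2 (by linarith)
  refine h ((κ/2 : ℝ) + (μ/2 : ℝ) * Complex.I) (by simp; positivity) ?_
  rw [hA']
  have hκc : (κ:ℂ)^2 = 2*ρ-b := by exact_mod_cast hκ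
  have hμc : (μ:ℂ)^2 = 2*ρ+b := by exact_mod_cast hμ
  push_cast
  set w : ℂ := (κ:ℂ)/2 + (μ:ℂ)/2 * Complex.I with hw
  have hq : w^2 - κ*w + ρ = 0 := by
    rw [hw]
    have := Complex.I_sq
    linear_combination (μ:ℂ)^2/4 * this - 1/4*hκc - 1/4*hμc
  linear_combination (C:ℂ) * (w^2 + κ*w+ρ) * hq + C*w^2*hκc

lemma quad_sum_s1 (a12 a34 a13 a24 a14 a23 α : ℝ) (h12 : 0 ≤ a12) (h34 : 0 ≤ a34) (h13 : 0 ≤ a13)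
    (h24 : 0 ≤ a24) (h14 : 0 ≤ a14) (h23 : 0 ≤ a23)
    (h : ∀ s t u : ℝ, 0 < s → 0 < t → 0 < u →
      2 * α ≤ a12*s + a34/s + a13*t + a24/t + a14*u + a23/u) :
    α ≤ √(a12*a34) + √(a13*a24) + √(a14*a23) := by
  have key : ∀ ε : ℝ, 0 < ε →
      α ≤ √((a12+ε)*(a34+ε)) + √((a13+ε)*(a24+ε)) + √((a14+ε)*(a23+ε)) := by
    intro ε hε
    have aux : ∀ a b : ℝ, 0 ≤ a → 0 ≤ b → ∃ s : ℝ, 0 < s ∧ a * s + b / s ≤ 2 * √((a+ε)*(b+ε)) := by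
      intro a b ha hb
      have pa : 0 < a + ε := by linarith
      have pb : 0 < b + ε := by linarith
      have sa := Real.sqrt_pos.2 pa
      have sb := Real.sqrt_pos.2 pb
      have qa := Real.sq_sqrt pa.le
      have qb := Real.sq_sqrt pb.le
      refine ⟨√(b+ε)/√(a+ε), by positivity, ?_⟩
      rw [Real.sqrt_mul pa.le]
      have e1 : (a+ε) * (√(b+ε)/√(a+ε)) = √(a+ε)*√(b+ε) := by
        nth_rewrite 1 [← qa]; field_simp
      have e2 : (b+ε) / (√(b+ε)/√(a+ε)) = √(a+ε)*√(b+ε) := by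
        nth_rewrite 1 [← qb]; field_simp
      have l1 : a * (√(b+ε)/√(a+ε)) ≤ (a+ε) * (√(b+ε)/√(a+ε)) := by gcongr; linarith
      have l2 : b / (√(b+ε)/√(a+ε)) ≤ (b+ε) / (√(b+ε)/√(a+ε)) := by gcongr; linarith
      linarith
    obtain ⟨s, hs, h1⟩ := aux a12 a34 h12 h34
    obtain ⟨t, ht, h2⟩ := aux a13 a24 h13 h24
    obtain ⟨u, hu, h3⟩ := aux a14 a23 h14 h23
    have := h s t u hs ht hu
    linarith
  have hc : Continuous (fun ε : ℝ =>
      √((a12+ε)*(a34+ε)) + √((a13+ε)*(a24+ε)) + √((a14+ε)*(a23+ε))) := by fun_prop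
  have ht := (hc.tendsto 0).mono_left (nhdsWithin_le_nhds (s := Set.Ioi (0:ℝ)))
  simp only [add_zero] at ht
  refine ge_of_tendsto ht ?_
  filter_upwards [self_mem_nhdsWithin] with ε hε using key ε hε

def Stab (η : P4 → ℝ) : Prop :=
  ∀ v : Fin 4 → ZMod 2 → ℂ, (∀ j, HH (v j)) → ∑ e, (η e : ℂ) * ∏ j, v j (e j) ≠ 0

lemma stab_core (η : ℝ → P4 → ℝ) (hc : ∀ e, Continuous fun t => η t e)
    (hs : ∀ t, 0 < t → t < 1 → Stab (η t)) (h0 : ∀ e, 0 ≤ η 0 e)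
    (ho : ∀ e : P4, ∑ j, e j ≠ 0 → η 0 e = 0) :
    √(η 0 ![0,0,0,0] * η 0 ![1,1,1,1]) ≤ √(η 0 ![1,1,0,0] * η 0 ![0,0,1,1])
     + √(η 0 ![1,0,1,0] * η 0 ![0,1,0,1]) + √(η 0 ![1,0,0,1] * η 0 ![0,1,1,0]) := by
  by_cases hA : η 0 ![0,0,0,0] = 0
  · rw [hA, zero_mul, Real.sqrt_zero]; positivity
  by_cases hC : η 0 ![1,1,1,1] = 0
  · rw [hC, mul_zero, Real.sqrt_zero]; positivity
  have hA := lt_of_le_of_ne (h0 _) (Ne.symm hA)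
  have hC := lt_of_le_of_ne (h0 _) (Ne.symm hC)
  apply quad_sum_s1 <;> try exact h0 _
  intro s t u hs0 ht0 hu0
  obtain ⟨c0, hc0, hc0s⟩ : ∃ c0 : ℝ, 0 < c0 ∧ c0^2 = s*t*u :=
    ⟨√(s*t*u), Real.sqrt_pos.2 (by positivity), Real.sq_sqrt (by positivity)⟩
  set c : Fin 4 → ℝ := ![c0, s/c0, t/c0, u/c0] with hcd
  have cpos : ∀ j, 0 < c j := by
    intro j; fin_cases j <;> simp [hcd] <;> positivity
  have hpoly : ∀ (θ : P4 → ℝ) (w : ℂ),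
      ∑ e, (θ e : ℂ) * ∏ j, (if e j = 0 then (1:ℂ) else c j * w) =
      (θ ![0,0,0,0] : ℂ) + (θ ![0,0,0,1] * c 3 + θ ![0,0,1,0] * c 2 + θ ![0,1,0,0] * c 1
        + θ ![1,0,0,0] * c 0) * w
      + (θ ![1,1,0,0] * (c 0 * c 1) + θ ![0,0,1,1] * (c 2 * c 3) + θ ![1,0,1,0] * (c 0 * c 2)
         + θ ![0,1,0,1] * (c 1 * c 3) + θ ![1,0,0,1] * (c 0 * c 3)
         + θ ![0,1,1,0] * (c 1 * c 2)) * w^2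
      + (θ ![1,1,1,0] * (c 0 * c 1 * c 2) + θ ![1,1,0,1] * (c 0 * c 1 * c 3)
        + θ ![1,0,1,1] * (c 0 * c 2 * c 3) + θ ![0,1,1,1] * (c 1 * c 2 * c 3)) * w^3
      + (θ ![1,1,1,1] * (c 0 * c 1 * c 2 * c 3)) * w^4 := by
    intro θ w
    rw [sum16]
    simp only [Fin.prod_univ_four, Matrix.cons_val, if_true, one_ne_zero, if_false]
    ring
  have hlow : ∀ w : ℂ, 0 ≤ w.re → ∀ t, 0 < t → t < 1 →
      |η t ![1,1,1,1] * (c 0 * c 1 * c 2 * c 3)| * w.re^4 ≤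
      ‖∑ e, (η t e : ℂ) * ∏ j, (if e j = 0 then (1:ℂ) else c j * w)‖ := by
    intro w hw t ht ht1
    rw [hpoly]
    have := hurw4 _ _ _ _ _ ?_ (fun w hw => by
      rw [← hpoly]
      refine hs t ht ht1 (fun j b => if b = 0 then (1:ℂ) else c j * w) ?_
      intro j
      refine ⟨by simp, ?_⟩
      simp only [if_true, one_ne_zero, if_false, one_mul, Complex.conj_re, Complex.re_ofReal_mul]
      exact mul_nonneg (cpos j).le hw) w hw
    · refine le_trans (le_of_eq ?_) this
      congr 1
      rw [← Real.norm_eq_abs, ← Complex.norm_real]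
      push_cast; rfl
    · have := hs t ht ht1 (fun j b => if b = 0 then (0:ℂ) else c j) (by
        intro j
        refine ⟨Or.inr ?_, by simp⟩
        simpa using (cpos j).ne')
      rw [sum16] at this
      simpa [Fin.prod_univ_four] using this
  have hlow0 : ∀ w : ℂ, 0 ≤ w.re → 
      |η 0 ![1,1,1,1] * (c 0 * c 1 * c 2 * c 3)| * w.re^4 ≤
      ‖∑ e, (η 0 e : ℂ) * ∏ j, (if e j = 0 then (1:ℂ) else c j * w)‖ := by
    intro w hw
    have k1 : Continuous (fun t => |η t ![1,1,1,1] * (c 0 * c 1 * c 2 * c 3)| * w.re^4) := by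
      have := hc ![1,1,1,1]
      fun_prop
    have k2 : Continuous (fun t =>
        ‖∑ e, (η t e : ℂ) * ∏ j, (if e j = 0 then (1:ℂ) else c j * w)‖) := by
      refine continuous_norm.comp (continuous_finsetSum _ fun e _ => ?_)
      exact (Complex.continuous_ofReal.comp (hc e)).mul continuous_const
    refine le_of_tendsto_of_tendsto
      ((k1.tendsto 0).mono_left (nhdsWithin_le_nhds (s := Set.Ioi (0:ℝ))))
      ((k2.tendsto 0).mono_left (nhdsWithin_le_nhds (s := Set.Ioi (0:ℝ)))) ?_
    filter_upwards [self_mem_nhdsWithin,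
      nhdsWithin_le_nhds (Iio_mem_nhds (zero_lt_one (α := ℝ)))] with t ht ht1
    exact hlow w hw t ht ht1
  have m0 : c 0 * c 1 = s := by simp [hcd]; field_simp
  have m1 : c 0 * c 2 = t := by simp [hcd]; field_simp
  have m2 : c 0 * c 3 = u := by simp [hcd]; field_simp
  have m3 : c 2 * c 3 = 1/s := by simp [hcd]; field_simp; rw [hc0s]; ring
  have m4 : c 1 * c 3 = 1/t := by simp [hcd]; field_simp; rw [hc0s]; ring
  have m5 : c 1 * c 2 = 1/u := by simp [hcd]; field_simp; rw [hc0s]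
  have m6 : c 0 * c 1 * c 2 * c 3 = 1 := by rw [mul_assoc, m0, m3]; field_simp
  have := biquad (η 0 ![0,0,0,0]) (η 0 ![1,1,0,0] * (c 0 * c 1) + η 0 ![0,0,1,1] * (c 2 * c 3)
      + η 0 ![1,0,1,0] * (c 0 * c 2)
         + η 0 ![0,1,0,1] * (c 1 * c 3) + η 0 ![1,0,0,1] * (c 0 * c 3)
         + η 0 ![0,1,1,0] * (c 1 * c 2)) (η 0 ![1,1,1,1] * (c 0 * c 1 * c 2 * c 3)) hA (by
      have := h0 ![1,1,0,0]; have := h0 ![0,0,1,1]; have := h0 ![1,0,1,0]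
      have := h0 ![0,1,0,1]; have := h0 ![1,0,0,1]; have := h0 ![0,1,1,0]
      have := (cpos 0).le; have := (cpos 1).le; have := (cpos 2).le; have := (cpos 3).le
      positivity) (by rw [m6, mul_one]; exact hC) (by
      intro w hw hw0
      have := hlow0 w hw.le
      rw [hpoly, ho ![0,0,0,1] (by decide), ho ![0,0,1,0] (by decide), ho ![0,1,0,0] (by decide),
        ho ![1,0,0,0] (by decide), ho ![1,1,1,0] (by decide), ho ![1,1,0,1] (by decide),
        ho ![1,0,1,1] (by decide), ho ![0,1,1,1] (by decide)] at this
      push_cast at hw0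
      simp only [Complex.ofReal_zero, zero_mul, add_zero] at this
      rw [hw0, norm_zero, m6, mul_one, abs_of_pos hC] at this
      have := mul_pos hC (pow_pos hw 4)
      linarith)
  rw [m6, mul_one, m0, m1, m2, m3, m4, m5] at this
  refine this.trans (le_of_eq ?_)
  ring

lemma HH.swap {v : ZMod 2 → ℂ} (h : HH v) (b : ZMod 2) : HH (fun x => v (x + b)) := by
  have hb : b = 0 ∨ b = 1 := by revert b; decide
  rcases hb with rfl | rfl
  · simpa using h
  · refine ⟨?_, ?_⟩
    · exact h.1.symm
    · have := h.2
      change 0 ≤ (v 1 * (starRingEnd ℂ) (v 0)).re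
      simp only [Complex.mul_re, Complex.conj_re, Complex.conj_im] at this ⊢
      linarith

lemma Stab.shift {η : P4 → ℝ} (h : Stab η) (σ : P4) : Stab (fun e => η (e + σ)) := by
  intro v hv
  have := h (fun j x => v j (x + σ j)) (fun j => (hv j).swap (σ j))
  rw [← Equiv.sum_comp (Equiv.addRight σ)] at this
  have e2 : ∀ x : ZMod 2, x + x = 0 := by decide
  simpa [add_assoc, e2] using this

lemma stab_cond (η : ℝ → P4 → ℝ) (hc : ∀ e, Continuous fun t => η t e)
    (hs : ∀ t, 0 < t → t < 1 → Stab (η t)) (h0 : ∀ e, 0 ≤ η 0 e)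
    (ho : ∀ e : P4, ∑ j, e j ≠ 0 → η 0 e = 0) : Cond (η 0) := by
  have hsh : ∀ σ : P4, ∑ j, σ j = 0 → _ := fun σ hσ =>
    stab_core (fun t e => η t (e + σ)) (fun e => hc _) (fun t h1 h2 => (hs t h1 h2).shift σ)
      (fun e => h0 _) (fun e he => ho _ (by simpa [Finset.sum_add_distrib, hσ] using he))
  have d1 : (![0,0,0,0] : P4) + ![1,1,0,0] = ![1,1,0,0] := by decide
  have d2 : (![1,1,1,1] : P4) + ![1,1,0,0] = ![0,0,1,1] := by decide
  have d3 : (![1,1,0,0] : P4) + ![1,1,0,0] = ![0,0,0,0] := by decide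
  have d4 : (![0,0,1,1] : P4) + ![1,1,0,0] = ![1,1,1,1] := by decide
  have d5 : (![1,0,1,0] : P4) + ![1,1,0,0] = ![0,1,1,0] := by decide
  have d6 : (![0,1,0,1] : P4) + ![1,1,0,0] = ![1,0,0,1] := by decide
  have d7 : (![1,0,0,1] : P4) + ![1,1,0,0] = ![0,1,0,1] := by decide
  have d8 : (![0,1,1,0] : P4) + ![1,1,0,0] = ![1,0,1,0] := by decide
  have f1 : (![0,0,0,0] : P4) + ![1,0,1,0] = ![1,0,1,0] := by decide
  have f2 : (![1,1,1,1] : P4) + ![1,0,1,0] = ![0,1,0,1] := by decide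
  have f3 : (![1,1,0,0] : P4) + ![1,0,1,0] = ![0,1,1,0] := by decide
  have f4 : (![0,0,1,1] : P4) + ![1,0,1,0] = ![1,0,0,1] := by decide
  have f5 : (![1,0,1,0] : P4) + ![1,0,1,0] = ![0,0,0,0] := by decide
  have f6 : (![0,1,0,1] : P4) + ![1,0,1,0] = ![1,1,1,1] := by decide
  have f7 : (![1,0,0,1] : P4) + ![1,0,1,0] = ![0,0,1,1] := by decide
  have f8 : (![0,1,1,0] : P4) + ![1,0,1,0] = ![1,1,0,0] := by decide
  have g1 : (![0,0,0,0] : P4) + ![1,0,0,1] = ![1,0,0,1] := by decide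
  have g2 : (![1,1,1,1] : P4) + ![1,0,0,1] = ![0,1,1,0] := by decide
  have g3 : (![1,1,0,0] : P4) + ![1,0,0,1] = ![0,1,0,1] := by decide
  have g4 : (![0,0,1,1] : P4) + ![1,0,0,1] = ![1,0,1,0] := by decide
  have g5 : (![1,0,1,0] : P4) + ![1,0,0,1] = ![0,0,1,1] := by decide
  have g6 : (![0,1,0,1] : P4) + ![1,0,0,1] = ![1,1,0,0] := by decide
  have g7 : (![1,0,0,1] : P4) + ![1,0,0,1] = ![0,0,0,0] := by decide
  have g8 : (![0,1,1,0] : P4) + ![1,0,0,1] = ![1,1,1,1] := by decide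
  have k1 := hsh ![1,1,0,0] (by decide)
  have k2 := hsh ![1,0,1,0] (by decide)
  have k3 := hsh ![1,0,0,1] (by decide)
  simp only [d1,d2,d3,d4,d5,d6,d7,d8] at k1
  simp only [f1,f2,f3,f4,f5,f6,f7,f8] at k2
  simp only [g1,g2,g3,g4,g5,g6,g7,g8] at k3
  have k0 := stab_core η hc hs h0 ho
  have sc : ∀ x y : ℝ, √(x*y) = √(y*x) := fun x y => by rw [mul_comm]
  have s1 := sc (η 0 ![0,1,1,0]) (η 0 ![1,0,0,1])
  have s2 := sc (η 0 ![0,1,0,1]) (η 0 ![1,0,1,0])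
  have s3 := sc (η 0 ![0,0,1,1]) (η 0 ![1,1,0,0])
  refine ⟨?_, ?_, ?_, ?_⟩ <;> linarith


def wt {m : ℕ} (a : Fin m → ZMod 2) : ℕ := ∑ i, (a i).val

def col {m : ℕ} (A : Fin m → P4) (j : Fin 4) : Fin m → ZMod 2 := fun i => A i j

noncomputable def ww (t : ℝ) (e : P4) : ℝ := if ∑ j, e j = 0 then 1 else t

noncomputable def cc (m k : ℕ) (b : ZMod 2) (d : ℕ) : ℝ :=
  if d + b.val = k then 1 / (m.choose d : ℝ) else 0

noncomputable def eta (m : ℕ) (k : Fin 4 → ℕ) (t : ℝ) (e : P4) : ℝ :=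
  ∑ A : Fin m → P4, (∏ i, ww t (A i)) * ∏ j, cc m (k j) (e j) (wt (col A j))

lemma wt_le {m : ℕ} (a : Fin m → ZMod 2) : wt a ≤ m := by
  unfold wt
  calc ∑ i, (a i).val ≤ ∑ _i : Fin m, 1 :=
        Finset.sum_le_sum fun i _ => Nat.lt_succ_iff.1 (ZMod.val_lt (a i))
    _ = m := by simp

lemma HH.norms {v : ZMod 2 → ℂ} (h : HH v) : v 0 + v 1 ≠ 0 ∧ ‖v 0 - v 1‖ ≤ ‖v 0 + v 1‖ := by
  obtain ⟨h1, h2⟩ := h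
  have e1 : ‖v 0 + v 1‖^2 = ‖v 0‖^2 + ‖v 1‖^2 + 2 * (v 0 * (starRingEnd ℂ) (v 1)).re := by
    rw [← Complex.normSq_eq_norm_sq, Complex.normSq_add, Complex.normSq_eq_norm_sq,
      Complex.normSq_eq_norm_sq]
  have e2 : ‖v 0 - v 1‖^2 = ‖v 0‖^2 + ‖v 1‖^2 - 2 * (v 0 * (starRingEnd ℂ) (v 1)).re := by
    rw [← Complex.normSq_eq_norm_sq, Complex.normSq_sub, Complex.normSq_eq_norm_sq,
      Complex.normSq_eq_norm_sq]
  constructor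
  · intro h0
    rw [h0, norm_zero] at e1
    have p0 := sq_nonneg ‖v 0‖
    have p1 := sq_nonneg ‖v 1‖
    rcases h1 with h | h
    · have : 0 < ‖v 0‖^2 := by positivity
      linarith
    · have : 0 < ‖v 1‖^2 := by positivity
      linarith
  · refine abs_le_of_sq_le_sq' ?_ (norm_nonneg _) |>.2
    rw [e1, e2]; linarith

lemma base_ne (t : ℝ) (ht : 0 < t) (ht1 : t < 1) : Stab (ww t) := by
  intro v hv h0
  have ev : ∀ e : P4, ∑ j, e j = 0 → ww t e = 1 := fun e he => if_pos he
  have od : ∀ e : P4, ∑ j, e j ≠ 0 → ww t e = t := fun e he => if_neg he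
  rw [sum16] at h0
  rw [ev ![0,0,0,0] (by decide), ev ![1,1,1,1] (by decide), ev ![1,1,0,0] (by decide),
    ev ![0,0,1,1] (by decide), ev ![1,0,1,0] (by decide), ev ![0,1,0,1] (by decide),
    ev ![1,0,0,1] (by decide), ev ![0,1,1,0] (by decide),
    od ![0,0,0,1] (by decide), od ![0,0,1,0] (by decide), od ![0,1,0,0] (by decide),
    od ![1,0,0,0] (by decide), od ![1,1,1,0] (by decide), od ![1,1,0,1] (by decide),
    od ![1,0,1,1] (by decide), od ![0,1,1,1] (by decide)] at h0
  simp only [Fin.prod_univ_four, Matrix.cons_val] at h0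
  have h1 : ((1+t : ℝ):ℂ) * ((v 0 0 + v 0 1) * (v 1 0 + v 1 1) * (v 2 0 + v 2 1) * (v 3 0 + v 3 1))
      = -(((1-t : ℝ):ℂ) *
       ((v 0 0 - v 0 1) * (v 1 0 - v 1 1) * (v 2 0 - v 2 1) * (v 3 0 - v 3 1))) := by
    push_cast at h0 ⊢
    linear_combination 2 * h0
  have h2 := congrArg norm h1
  rw [norm_neg] at h2
  simp only [norm_mul, Complex.norm_real, Real.norm_eq_abs] at h2
  rw [abs_of_pos (by linarith), abs_of_pos (by linarith)] at h2
  have hle : ‖v 0 0 - v 0 1‖ * ‖v 1 0 - v 1 1‖ * ‖v 2 0 - v 2 1‖ * ‖v 3 0 - v 3 1‖ ≤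
      ‖v 0 0 + v 0 1‖ * ‖v 1 0 + v 1 1‖ * ‖v 2 0 + v 2 1‖ * ‖v 3 0 + v 3 1‖ := by
    have := (hv 0).norms.2; have := (hv 1).norms.2
    have := (hv 2).norms.2; have := (hv 3).norms.2
    gcongr
  have hpos : 0 < ‖v 0 0 + v 0 1‖ * ‖v 1 0 + v 1 1‖ * ‖v 2 0 + v 2 1‖ * ‖v 3 0 + v 3 1‖ := by
    have := norm_pos_iff.2 (hv 0).norms.1; have := norm_pos_iff.2 (hv 1).norms.1
    have := norm_pos_iff.2 (hv 2).norms.1; have := norm_pos_iff.2 (hv 3).norms.1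
    positivity
  generalize ‖v 0 0 + v 0 1‖ * ‖v 1 0 + v 1 1‖ * ‖v 2 0 + v 2 1‖ * ‖v 3 0 + v 3 1‖ = X at *
  generalize ‖v 0 0 - v 0 1‖ * ‖v 1 0 - v 1 1‖ * ‖v 2 0 - v 2 1‖ * ‖v 3 0 - v 3 1‖ = Y at *
  nlinarith

lemma pow_wt {m : ℕ} (v : ZMod 2 → ℂ) (a : Fin m → ZMod 2) :
    v 1 ^ wt a * v 0 ^ (m - wt a) = ∏ i, v (a i) := by
  have hz : ∀ b : ZMod 2, v b = v 1 ^ b.val * v 0 ^ (1 - b.val) := by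
    intro b
    have hb : b = 0 ∨ b = 1 := by revert b; decide
    rcases hb with rfl | rfl
    · simp
    · simp [ZMod.val_one]
  have hm : m - wt a = ∑ i, (1 - (a i).val) := by
    have : ∑ i, (1 - (a i).val) + wt a = m := by
      unfold wt
      rw [← Finset.sum_add_distrib]
      calc ∑ i, (1 - (a i).val + (a i).val) = ∑ _i : Fin m, 1 :=
            Finset.sum_congr rfl fun i _ => by
              have := ZMod.val_lt (a i); omega
        _ = m := by simp
    omega
  rw [hm, wt, ← Finset.prod_pow_eq_pow_sum, ← Finset.prod_pow_eq_pow_sum, ← Finset.prod_mul_distrib]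
  exact Finset.prod_congr rfl fun i _ => (hz _).symm

lemma phi_eq (m k : ℕ) (v : ZMod 2 → ℂ) (d : ℕ) :
    phi m k v d = ∑ b, (cc m k b d : ℂ) * v b := by
  rw [sumZ]
  unfold phi cc
  simp only [ZMod.val_zero, ZMod.val_one, add_zero]
  by_cases h1 : d = k
  · subst h1
    simp; ring
  · by_cases h2 : d + 1 = k
    · subst h2; simp; ring
    · simp [h1, h2]

lemma stab_eta (m : ℕ) (k : Fin 4 → ℕ) (hk1 : ∀ j, 1 ≤ k j) (hkm : ∀ j, k j ≤ m) (t : ℝ)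
    (ht : 0 < t) (ht1 : t < 1) : Stab (eta m k t) := by
  have S0 : ∀ v : Fin 4 → ZMod 2 → ℂ, (∀ j, HH (v j)) →
      ∑ A : Fin m → P4, (∏ i, (ww t (A i) : ℂ)) * ∏ j, (v j 1 ^ wt (col A j)
        * v j 0 ^ (m - wt (col A j))) ≠ 0 := by
    intro v hv
    have : ∑ A : Fin m → P4, (∏ i, (ww t (A i) : ℂ)) * ∏ j, (v j 1 ^ wt (col A j)
        * v j 0 ^ (m - wt (col A j))) = (∑ e, (ww t e : ℂ) * ∏ j, v j (e j)) ^ m := by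
      rw [Fintype.sum_pow]
      refine Finset.sum_congr rfl fun A _ => ?_
      simp only [pow_wt]
      rw [Finset.prod_comm, ← Finset.prod_mul_distrib]
      rfl
    rw [this]
    exact pow_ne_zero _ (base_ne t ht ht1 v hv)
  simp only [Fin.prod_univ_four] at S0
  have S1 : ∀ v : Fin 4 → ZMod 2 → ℂ, (∀ j, HH (v j)) →
      ∑ A : Fin m → P4, ((∏ i, (ww t (A i) : ℂ)) * (v 1 1 ^ wt (col A 1) * v 1 0 ^ (m - wt (col A 1)))
       * (v 2 1 ^ wt (col A 2) * v 2 0 ^ (m - wt (col A 2)))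
       * (v 3 1 ^ wt (col A 3) * v 3 0 ^ (m - wt (col A 3))))
        * phi m (k 0) (v 0) (wt (col A 0)) ≠ 0 := by
    intro v hv
    refine lemmaU m (k 0) _ _ (fun A => wt_le _) (hk1 _) (hkm _) ?_ (v 0) (hv 0)
    intro x hx
    have := S0 ![x, v 1, v 2, v 3] (by intro j; fin_cases j; exacts [hx, hv 1, hv 2, hv 3])
    simp only [Matrix.cons_val] at this
    refine ne_of_eq_of_ne (Finset.sum_congr rfl fun A _ => ?_) this
    ring
  have S2 : ∀ v : Fin 4 → ZMod 2 → ℂ, (∀ j, HH (v j)) →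
      ∑ A : Fin m → P4, ((∏ i, (ww t (A i) : ℂ)) * phi m (k 0) (v 0) (wt (col A 0))
       * (v 2 1 ^ wt (col A 2) * v 2 0 ^ (m - wt (col A 2)))
       * (v 3 1 ^ wt (col A 3) * v 3 0 ^ (m - wt (col A 3))))
        * phi m (k 1) (v 1) (wt (col A 1)) ≠ 0 := by
    intro v hv
    refine lemmaU m (k 1) _ _ (fun A => wt_le _) (hk1 _) (hkm _) ?_ (v 1) (hv 1)
    intro x hx
    have := S1 ![v 0, x, v 2, v 3] (by intro j; fin_cases j; exacts [hv 0, hx, hv 2, hv 3])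
    simp only [Matrix.cons_val] at this
    refine ne_of_eq_of_ne (Finset.sum_congr rfl fun A _ => ?_) this
    ring
  have S3 : ∀ v : Fin 4 → ZMod 2 → ℂ, (∀ j, HH (v j)) →
      ∑ A : Fin m → P4, ((∏ i, (ww t (A i) : ℂ)) * phi m (k 0) (v 0) (wt (col A 0))
       * phi m (k 1) (v 1) (wt (col A 1))
       * (v 3 1 ^ wt (col A 3) * v 3 0 ^ (m - wt (col A 3))))
        * phi m (k 2) (v 2) (wt (col A 2)) ≠ 0 := by
    intro v hv
    refine lemmaU m (k 2) _ _ (fun A => wt_le _) (hk1 _) (hkm _) ?_ (v 2) (hv 2)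
    intro x hx
    have := S2 ![v 0, v 1, x, v 3] (by intro j; fin_cases j; exacts [hv 0, hv 1, hx, hv 3])
    simp only [Matrix.cons_val] at this
    refine ne_of_eq_of_ne (Finset.sum_congr rfl fun A _ => ?_) this
    ring
  have S4 : ∀ v : Fin 4 → ZMod 2 → ℂ, (∀ j, HH (v j)) →
      ∑ A : Fin m → P4, ((∏ i, (ww t (A i) : ℂ)) * phi m (k 0) (v 0) (wt (col A 0))
       * phi m (k 1) (v 1) (wt (col A 1)) * phi m (k 2) (v 2) (wt (col A 2)))
        * phi m (k 3) (v 3) (wt (col A 3)) ≠ 0 := by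
    intro v hv
    refine lemmaU m (k 3) _ _ (fun A => wt_le _) (hk1 _) (hkm _) ?_ (v 3) (hv 3)
    intro x hx
    have := S3 ![v 0, v 1, v 2, x] (by intro j; fin_cases j; exacts [hv 0, hv 1, hv 2, hx])
    simp only [Matrix.cons_val] at this
    refine ne_of_eq_of_ne (Finset.sum_congr rfl fun A _ => ?_) this
    ring
  intro v hv
  refine ne_of_eq_of_ne ?_ (S4 v hv)
  have hx : ∀ A : Fin m → P4, ((∏ i, (ww t (A i) : ℂ)) * phi m (k 0) (v 0) (wt (col A 0))
       * phi m (k 1) (v 1) (wt (col A 1)) * phi m (k 2) (v 2) (wt (col A 2)))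
        * phi m (k 3) (v 3) (wt (col A 3)) =
      ∑ e : P4, (∏ i, (ww t (A i) : ℂ)) * ∏ j, ((cc m (k j) (e j) (wt (col A j)) : ℂ) * v j (e j)) := by
    intro A
    have h1 := Finset.prod_univ_sum (fun _ : Fin 4 => (Finset.univ : Finset (ZMod 2)))
      (fun j b => (cc m (k j) b (wt (col A j)) : ℂ) * v j b)
    rw [Fintype.piFinset_univ] at h1
    rw [← Finset.mul_sum, ← h1, Fin.prod_univ_four]
    simp only [phi_eq]
    ring
  rw [Finset.sum_congr rfl fun A _ => hx A, Finset.sum_comm]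
  refine Finset.sum_congr rfl fun e _ => ?_
  unfold eta
  push_cast
  rw [Finset.sum_mul]
  refine Finset.sum_congr rfl fun A _ => ?_
  rw [Finset.prod_mul_distrib]
  ring

lemma cont_eta (m : ℕ) (k : Fin 4 → ℕ) (e : P4) : Continuous fun t => eta m k t e := by
  unfold eta
  refine continuous_finsetSum _ fun A _ => ?_
  refine Continuous.mul (continuous_finsetProd _ fun i _ => ?_) continuous_const
  unfold ww
  split_ifs
  · exact continuous_const
  · exact continuous_id

lemma eta_nonneg (m : ℕ) (k : Fin 4 → ℕ) (e : P4) : 0 ≤ eta m k 0 e := by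
  unfold eta
  refine Finset.sum_nonneg fun A _ => mul_nonneg (Finset.prod_nonneg fun i _ => ?_)
    (Finset.prod_nonneg fun j _ => ?_)
  · unfold ww; split_ifs <;> norm_num
  · unfold cc; split_ifs <;> positivity

lemma wt_cast {m : ℕ} (a : Fin m → ZMod 2) : ((wt a : ℕ) : ZMod 2) = ∑ i, a i := by
  unfold wt
  push_cast
  refine Finset.sum_congr rfl fun i _ => ?_
  simp

lemma eta_odd (m : ℕ) (k : Fin 4 → ℕ) (hk : ((∑ j, k j : ℕ) : ZMod 2) = 0) (e : P4)
    (he : ∑ j, e j ≠ 0) : eta m k 0 e = 0 := by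
  unfold eta
  refine Finset.sum_eq_zero fun A _ => ?_
  by_contra hne
  obtain ⟨h1, h2⟩ := mul_ne_zero_iff.1 hne
  rw [Finset.prod_ne_zero_iff] at h1 h2
  have r1 : ∀ i, ∑ j, A i j = 0 := by
    intro i
    have := h1 i (Finset.mem_univ _)
    unfold ww at this
    by_contra hc
    simp [hc] at this
  have r2 : ∀ j, wt (col A j) + (e j).val = k j := by
    intro j
    have := h2 j (Finset.mem_univ _)
    unfold cc at this
    by_contra hc
    simp [hc] at this
  apply he
  simp only [← r2] at hk
  push_cast at hk
  simp only [wt_cast, ZMod.natCast_val, ZMod.cast_id', id] at hk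
  rw [Finset.sum_add_distrib, Finset.sum_comm] at hk
  unfold col at hk
  simpa [r1] using hk

lemma cond_eta (m : ℕ) (k : Fin 4 → ℕ) (hk1 : ∀ j, 1 ≤ k j) (hkm : ∀ j, k j ≤ m)
    (hk : ((∑ j, k j : ℕ) : ZMod 2) = 0) : Cond (eta m k 0) :=
  stab_cond (eta m k) (cont_eta m k) (fun t h1 h2 => stab_eta m k hk1 hkm t h1 h2)
    (eta_nonneg m k) (eta_odd m k hk)


noncomputable def ind {m : ℕ} (k : ℤ) (a : Fin m → ZMod 2) : ℝ := if (wt a : ℤ) = k then 1 else 0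

noncomputable def EE {m : ℕ} (f : Fin 4 → (Fin m → ZMod 2) → ℝ) : ℝ :=
  ∑ A : Fin m → P4, (∏ i, ww 0 (A i)) * ∏ j, f j (col A j)

noncomputable def NN (m : ℕ) (k : Fin 4 → ℤ) : ℝ := EE (m := m) (fun j => ind (k j))

noncomputable def sl (m : ℕ) (k : ℤ) : ℝ := ∑ a : Fin m → ZMod 2, ind k a

noncomputable def pp (m : ℕ) (k : Fin 4 → ℤ) (e : P4) : ℝ :=
  ww 0 e * NN m (fun j => k j - ((e j).val : ℤ))

lemma ww0_nonneg (e : P4) : 0 ≤ ww 0 e := by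
  unfold ww; split_ifs <;> norm_num

lemma ind_nonneg {m : ℕ} (k : ℤ) (a : Fin m → ZMod 2) : 0 ≤ ind k a := by
  unfold ind; split_ifs <;> norm_num

lemma EE_nonneg {m : ℕ} (f : Fin 4 → (Fin m → ZMod 2) → ℝ) (hf : ∀ j a, 0 ≤ f j a) : 0 ≤ EE f :=
  Finset.sum_nonneg fun _ _ => mul_nonneg (Finset.prod_nonneg fun _ _ => ww0_nonneg _)
    (Finset.prod_nonneg fun _ _ => hf _ _)

lemma NN_nonneg (m : ℕ) (k : Fin 4 → ℤ) : 0 ≤ NN m k := EE_nonneg _ fun _ _ => ind_nonneg _ _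

lemma sl_nonneg (m : ℕ) (k : ℤ) : 0 ≤ sl m k := Finset.sum_nonneg fun _ _ => ind_nonneg _ _

lemma pp_nonneg (m : ℕ) (k : Fin 4 → ℤ) (e : P4) : 0 ≤ pp m k e :=
  mul_nonneg (ww0_nonneg _) (NN_nonneg _ _)

lemma pp_odd (m : ℕ) (k : Fin 4 → ℤ) (e : P4) (he : ∑ j, e j ≠ 0) : pp m k e = 0 := by
  unfold pp ww; rw [if_neg he, zero_mul]

lemma NN_ne (m : ℕ) (k : Fin 4 → ℤ) (h : NN m k ≠ 0) :
    ∃ A : Fin m → P4, (∀ i, ∑ j, A i j = 0) ∧ ∀ j, (wt (col A j) : ℤ) = k j := by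
  obtain ⟨A, _, hA⟩ := Finset.exists_ne_zero_of_sum_ne_zero h
  refine ⟨A, ?_, ?_⟩
  · intro i
    have := Finset.prod_ne_zero_iff.1 (mul_ne_zero_iff.1 hA).1 i (Finset.mem_univ _)
    unfold ww at this
    by_contra hc
    simp [hc] at this
  · intro j
    have := Finset.prod_ne_zero_iff.1 (mul_ne_zero_iff.1 hA).2 j (Finset.mem_univ _)
    unfold ind at this
    by_contra hc
    simp [hc] at this

lemma cond_pp (m : ℕ) (k : Fin 4 → ℤ) : Cond (pp m k) := by
  by_cases hgood : ∀ j, 1 ≤ k j ∧ k j ≤ m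
  swap
  · push Not at hgood
    obtain ⟨j, hj⟩ := hgood
    have hz : ∀ e e' : P4, e j ≠ e' j → pp m k e * pp m k e' = 0 := by
      intro e e' hne
      by_contra hc
      obtain ⟨h1, h2⟩ := mul_ne_zero_iff.1 hc
      obtain ⟨A, _, hA⟩ := NN_ne _ _ (mul_ne_zero_iff.1 h1).2
      obtain ⟨A', _, hA'⟩ := NN_ne _ _ (mul_ne_zero_iff.1 h2).2
      have a1 := hA j
      have a2 := hA' j
      have b1 := wt_le (col A j)
      have b2 := wt_le (col A' j)
      have c : ∀ x y : ZMod 2, x ≠ y → (x.val = 0 ∧ y.val = 1) ∨ (x.val = 1 ∧ y.val = 0) := by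
        decide
      rcases c _ _ hne with ⟨u1, u2⟩ | ⟨u1, u2⟩ <;> rw [u1] at a1 <;> rw [u2] at a2 <;>
        push_cast at a1 a2 <;> by_cases hk : 1 ≤ k j
      · have := hj hk; omega
      · omega
      · have := hj hk; omega
      · omega
    have d1 : ∀ j, (![0,0,0,0] : P4) j ≠ ![1,1,1,1] j := by decide
    have d2 : ∀ j, (![1,1,0,0] : P4) j ≠ ![0,0,1,1] j := by decide
    have d3 : ∀ j, (![1,0,1,0] : P4) j ≠ ![0,1,0,1] j := by decide
    have d4 : ∀ j, (![1,0,0,1] : P4) j ≠ ![0,1,1,0] j := by decide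
    unfold Cond QC
    rw [hz _ _ (d1 j), hz _ _ (d2 j), hz _ _ (d3 j), hz _ _ (d4 j)]
    simp
  obtain ⟨κ, hκ⟩ : ∃ κ : Fin 4 → ℕ, ∀ j, k j = κ j :=
    ⟨fun j => (k j).toNat, fun j => by have := hgood j; exact (Int.toNat_of_nonneg (by omega)).symm⟩
  have h1 : ∀ j, 1 ≤ κ j := fun j => by have := hgood j; have := hκ j; omega
  have h2 : ∀ j, κ j ≤ m := fun j => by have := hgood j; have := hκ j; omega
  by_cases hpar : ((∑ j, κ j : ℕ) : ZMod 2) = 0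
  · have : pp m k = fun e => eta m κ 0 e * ∏ j, ((m.choose (κ j - (e j).val) : ℕ) : ℝ) := by
      funext e
      by_cases he : ∑ j, e j = 0
      · unfold pp NN EE eta
        rw [ww, if_pos he, one_mul, Finset.sum_mul]
        refine Finset.sum_congr rfl fun A _ => ?_
        rw [mul_assoc, ← Finset.prod_mul_distrib]
        congr 1
        refine Finset.prod_congr rfl fun j _ => ?_
        unfold ind cc
        beta_reduce
        have hlt := ZMod.val_lt (e j)
        have := h1 j
        have := hκ j
        by_cases hw : wt (col A j) + (e j).val = κ j
        · rw [if_pos hw, if_pos (by omega)]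
          have hc : κ j - (e j).val = wt (col A j) := by omega
          rw [hc]
          have : ((m.choose (wt (col A j)) : ℕ) : ℝ) ≠ 0 := by
            exact_mod_cast (Nat.choose_pos (wt_le _)).ne'
          field_simp
        · rw [if_neg hw, if_neg (by omega), zero_mul]
      · rw [pp_odd _ _ _ he, eta_odd m κ hpar e he, zero_mul]
    rw [this]
    exact cond_tilt (eta m κ 0) (fun j b => ((m.choose (κ j - b.val) : ℕ) : ℝ))
      (fun _ _ => Nat.cast_nonneg _) (cond_eta m κ h1 h2 hpar)
  · have hz : ∀ e, pp m k e = 0 := by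
      intro e
      by_contra hc
      have he : ∑ j, e j = 0 := by
        by_contra he
        exact hc (pp_odd _ _ _ he)
      obtain ⟨A, hA1, hA2⟩ := NN_ne _ _ (mul_ne_zero_iff.1 hc).2
      apply hpar
      have r2 : ∀ j, wt (col A j) + (e j).val = κ j := by
        intro j
        have := hA2 j
        have := hκ j
        omega
      simp only [← r2]
      push_cast
      simp only [wt_cast, ZMod.natCast_val, ZMod.cast_id', id]
      rw [Finset.sum_add_distrib, Finset.sum_comm, he, add_zero]
      exact Finset.sum_eq_zero fun i _ => hA1 i
    unfold Cond QC
    simp [hz]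

lemma wt_cons {m : ℕ} (b : ZMod 2) (a : Fin m → ZMod 2) :
    wt (Fin.cons b a : Fin (m+1) → ZMod 2) = b.val + wt a := by
  unfold wt; rw [Fin.sum_univ_succ]; simp

lemma ind_cons {m : ℕ} (k : ℤ) (b : ZMod 2) (a : Fin m → ZMod 2) :
    ind k (Fin.cons b a : Fin (m+1) → ZMod 2) = ind (k - (b.val : ℤ)) a := by
  unfold ind
  rw [wt_cons]
  congr 1
  apply propext
  push_cast
  constructor <;> intro h <;> linarith

lemma col_cons {m : ℕ} (e : P4) (A : Fin m → P4) (j : Fin 4) :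
    col (Fin.cons e A : Fin (m+1) → P4) j = Fin.cons (e j) (col A j) := by
  funext i
  refine Fin.cases ?_ (fun i => ?_) i <;> simp [col]

lemma EE_succ {m : ℕ} (f : Fin 4 → (Fin (m+1) → ZMod 2) → ℝ) :
    EE f = ∑ e, ww 0 e * EE (fun j a => f j (Fin.cons (e j) a)) := by
  unfold EE
  rw [sumCons]
  refine Finset.sum_congr rfl fun e _ => ?_
  rw [Finset.mul_sum]
  refine Finset.sum_congr rfl fun A _ => ?_
  rw [Fin.prod_univ_succ]
  simp only [Fin.cons_zero, Fin.cons_succ, col_cons]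
  ring

lemma NN_succ (m : ℕ) (k : Fin 4 → ℤ) : NN (m+1) k = ∑ e, pp m k e := by
  unfold NN
  rw [EE_succ]
  simp only [ind_cons]
  rfl

lemma sl_succ (m : ℕ) (k : ℤ) : sl (m+1) k = ∑ b : ZMod 2, sl m (k - (b.val : ℤ)) := by
  unfold sl
  rw [sumCons]
  simp only [ind_cons]

lemma perm_avg {α : Type*} [Fintype α] {m : ℕ} (Φ : (Fin (m+1) → α) → ℝ)
    (hΦ : ∀ (σ : Equiv.Perm (Fin (m+1))) A, Φ (fun i => A (σ i)) = Φ A) (g : α → ℝ) :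
    ((m : ℝ) + 1) * ∑ A, Φ A * g (A 0) = ∑ A, Φ A * ∑ i, g (A i) := by
  have h : ∀ i, ∑ A, Φ A * g (A i) = ∑ A, Φ A * g (A 0) := by
    intro i
    rw [← Equiv.sum_comp (Equiv.arrowCongr (Equiv.swap 0 i) (Equiv.refl α))]
    refine Finset.sum_congr rfl fun A _ => ?_
    have e1 : (Equiv.arrowCongr (Equiv.swap 0 i) (Equiv.refl α)) A
        = fun l => A (Equiv.swap 0 i l) := by
      funext l; simp [Equiv.arrowCongr]
    rw [e1, hΦ]
    simp
  simp only [Finset.mul_sum (s := (Finset.univ : Finset (Fin (m+1))))]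
  rw [Finset.sum_comm (s := (Finset.univ : Finset (Fin (m+1) → α)))]
  simp only [h]
  simp

lemma marg1 (m : ℕ) (k : Fin 4 → ℤ) (j : Fin 4) :
    ((m:ℝ)+1) * ∑ e : P4, pp m k e * ((e j).val : ℝ) = k j * NN (m+1) k := by
  have h := perm_avg (m := m) (fun A : Fin (m+1) → P4 => (∏ i, ww 0 (A i)) * ∏ j, ind (k j) (col A j))
    (by
      intro σ A
      have hw : ∀ j, wt (col (fun i => A (σ i)) j) = wt (col A j) := by
        intro j
        unfold wt col
        exact Equiv.sum_comp σ (fun i => (A i j).val)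
      simp only [ind, hw]
      rw [Equiv.prod_comp σ (fun i => ww 0 (A i))]) (fun e => ((e j).val : ℝ))
  rw [sumCons] at h
  have l : ∑ e : P4, pp m k e * ((e j).val : ℝ) = ∑ e : P4, ∑ a : Fin m → P4,
      (∏ i, ww 0 ((Fin.cons e a : Fin (m+1) → P4) i)) *
        (∏ j, ind (k j) (col (Fin.cons e a : Fin (m+1) → P4) j)) *
        (((Fin.cons e a : Fin (m+1) → P4) 0 j).val : ℝ) := by
    refine Finset.sum_congr rfl fun e _ => ?_
    unfold pp NN EE
    rw [Finset.mul_sum, Finset.sum_mul]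
    refine Finset.sum_congr rfl fun A _ => ?_
    rw [Fin.prod_univ_succ (n := m)]
    simp only [Fin.cons_zero, Fin.cons_succ, col_cons, ind_cons]
    ring
  rw [l, h]
  unfold NN EE
  rw [Finset.mul_sum]
  refine Finset.sum_congr rfl fun A _ => ?_
  have e1 : ∑ i, ((A i j).val : ℝ) = (wt (col A j) : ℝ) := by
    unfold wt col; push_cast; rfl
  rw [e1]
  by_cases hw : (wt (col A j) : ℤ) = k j
  · have : (wt (col A j) : ℝ) = (k j : ℝ) := by exact_mod_cast hw
    rw [this]; ring
  · have : ∏ j, ind (k j) (col A j) = 0 :=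
      Finset.prod_eq_zero (Finset.mem_univ j) (by unfold ind; rw [if_neg hw])
    rw [this]; ring

lemma marg_sl (m : ℕ) (k : ℤ) : ((m:ℝ)+1) * sl m (k - 1) = k * sl (m+1) k := by
  have h := perm_avg (m := m) (fun a : Fin (m+1) → ZMod 2 => ind k a)
    (by
      intro σ A
      have hw : wt (fun i => A (σ i)) = wt A := by
        unfold wt
        exact Equiv.sum_comp σ (fun i => (A i).val)
      simp only [ind, hw]) (fun b => (b.val : ℝ))
  rw [sumCons, sumZ] at h
  simp only [Fin.cons_zero, ZMod.val_zero, ZMod.val_one, ind_cons, Nat.cast_zero, mul_zero,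
    Finset.sum_const_zero, zero_add, Nat.cast_one, mul_one] at h
  unfold sl
  rw [h, Finset.mul_sum]
  refine Finset.sum_congr rfl fun A _ => ?_
  have e1 : ∑ i, ((A i).val : ℝ) = (wt A : ℝ) := by
    unfold wt; push_cast; rfl
  rw [e1]
  unfold ind
  by_cases hw : (wt A : ℤ) = k
  · have : (wt A : ℝ) = (k : ℝ) := by exact_mod_cast hw
    rw [this]; ring
  · rw [if_neg hw]; ring

lemma marg_s1 (m : ℕ) (k : Fin 4 → ℤ) (j : Fin 4) (b : ZMod 2) :
    NN (m+1) k * sl m (k j - (b.val : ℤ)) =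
      sl (m+1) (k j) * ∑ e : P4, if e j = b then pp m k e else 0 := by
  have hm : ((m:ℝ)+1) ≠ 0 := by positivity
  have h1 : NN (m+1) k * sl m (k j - 1) =
      sl (m+1) (k j) * ∑ e : P4, if e j = 1 then pp m k e else 0 := by
    have a1 := marg1 m k j
    have a2 := marg_sl m (k j)
    have : ∑ e : P4, pp m k e * ((e j).val : ℝ) = ∑ e : P4, if e j = 1 then pp m k e else 0 := by
      refine Finset.sum_congr rfl fun e _ => ?_
      have hb : ∀ b : ZMod 2, b = 0 ∨ b = 1 := by decide
      rcases hb (e j) with h | h <;> simp [h, ZMod.val_one]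
    rw [this] at a1
    apply mul_left_cancel₀ hm
    linear_combination NN (m+1) k * a2 - sl (m+1) (k j) * a1
  have hb : b = 0 ∨ b = 1 := by revert b; decide
  rcases hb with rfl | rfl
  · have s1 := sl_succ m (k j)
    rw [sumZ] at s1
    have s2 := NN_succ m k
    have s3 : ∑ e, pp m k e = (∑ e : P4, if e j = 0 then pp m k e else 0)
        + ∑ e : P4, if e j = 1 then pp m k e else 0 := by
      rw [← Finset.sum_add_distrib]
      refine Finset.sum_congr rfl fun e _ => ?_
      have hb : ∀ b : ZMod 2, b = 0 ∨ b = 1 := by decide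
      rcases hb (e j) with h | h <;> simp [h]
    simp only [ZMod.val_zero, ZMod.val_one, Nat.cast_zero, Nat.cast_one, sub_zero] at s1 ⊢
    rw [s3] at s2
    linear_combination sl (m+1) (k j) * s2 - NN (m+1) k * s1 - h1
  · simpa [ZMod.val_one] using h1

theorem mainInd (m : ℕ) : ∀ (k : Fin 4 → ℤ) (f : Fin 4 → (Fin m → ZMod 2) → ℝ),
    (∀ j a, 0 ≤ f j a) → (∀ j a, f j a ≠ 0 → (wt a : ℤ) = k j) →
    EE f ≤ NN m k * ∏ j, (√(∑ a, f j a ^ 2) / √(sl m (k j))) := by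
  induction m with
  | zero =>
    intro k f hf hs
    by_cases h : ∀ j, k j = 0
    · have e1 : ∀ j, √(sl 0 (k j)) = 1 := by
        intro j; simp [sl, ind, wt, h j]
      have e2 : NN 0 k = 1 := by
        simp [NN, EE, ind, wt, h]
      rw [e2, one_mul]
      unfold EE
      simp only [Finset.univ_unique, Finset.sum_singleton, Finset.univ_eq_empty,
        Finset.prod_empty, one_mul, e1, div_one]
      refine le_of_eq (Finset.prod_congr rfl fun j _ => ?_)
      rw [Real.sqrt_sq (hf _ _)]
      congr 1
      exact Subsingleton.elim _ _
    · push Not at h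
      obtain ⟨j, hj⟩ := h
      have : EE f = 0 := by
        unfold EE
        refine Finset.sum_eq_zero fun A _ => ?_
        rw [Finset.prod_eq_zero (Finset.mem_univ j), mul_zero]
        by_contra hc
        have := hs _ _ hc
        simp [wt] at this
        exact hj this.symm
      rw [this]
      exact mul_nonneg (NN_nonneg _ _) (Finset.prod_nonneg fun _ _ => by positivity)
  | succ m ih =>
    intro k f hf hs
    set u : Fin 4 → ZMod 2 → ℝ := fun j b =>
      √(∑ a : Fin m → ZMod 2, f j (Fin.cons b a) ^ 2) / √(sl m (k j - (b.val : ℤ))) with hu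
    have hu0 : ∀ j b, 0 ≤ u j b := fun j b => by simp only [hu]; positivity
    have step1 : EE f ≤ ∑ e, pp m k e * ∏ j, u j (e j) := by
      rw [EE_succ]
      refine Finset.sum_le_sum fun e _ => ?_
      unfold pp
      rw [mul_assoc]
      refine mul_le_mul_of_nonneg_left ?_ (ww0_nonneg e)
      refine ih (fun j => k j - ((e j).val : ℤ)) (fun j a => f j (Fin.cons (e j) a))
        (fun j a => hf _ _) (fun j a ha => ?_)
      have := hs _ _ ha
      rw [wt_cons] at this
      push_cast at this
      linarith
    refine step1.trans ((four_ineq (pp m k) (pp_nonneg m k) (pp_odd m k) (cond_pp m k) u hu0).trans ?_)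
    rw [← NN_succ]
    by_cases hN : NN (m+1) k = 0
    · simp [hN]
    refine le_of_eq ?_
    congr 1
    refine Finset.prod_congr rfl fun j _ => ?_
    have hsl : sl (m+1) (k j) ≠ 0 := by
      obtain ⟨A, _, hA⟩ := NN_ne _ _ hN
      intro h0
      have := (Finset.sum_eq_zero_iff_of_nonneg (fun a _ => ind_nonneg (k j) a)).1 h0
        (col A j) (Finset.mem_univ _)
      unfold ind at this
      rw [if_pos (hA j)] at this
      exact one_ne_zero this
    have hub : ∀ b, u j b ^ 2 * sl m (k j - (b.val : ℤ)) =
        ∑ a : Fin m → ZMod 2, f j (Fin.cons b a) ^ 2 := by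
      intro b
      have hn : 0 ≤ ∑ a : Fin m → ZMod 2, f j (Fin.cons b a) ^ 2 :=
        Finset.sum_nonneg fun _ _ => sq_nonneg _
      simp only [hu]
      rw [div_pow, Real.sq_sqrt hn, Real.sq_sqrt (sl_nonneg _ _)]
      by_cases h0 : sl m (k j - (b.val : ℤ)) = 0
      · rw [h0, mul_zero]
        symm
        refine Finset.sum_eq_zero fun a _ => ?_
        by_contra hc
        have hc' : f j (Fin.cons b a) ≠ 0 := fun h => hc (by rw [h]; simp)
        have h1 := hs _ _ hc'
        rw [wt_cons] at h1
        have := (Finset.sum_eq_zero_iff_of_nonneg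
          (fun a _ => ind_nonneg (k j - (b.val : ℤ)) a)).1 h0 a (Finset.mem_univ _)
        unfold ind at this
        rw [if_pos (by push_cast at h1; linarith)] at this
        exact one_ne_zero this
      · field_simp
    have hsum : ∑ e, pp m k e * u j (e j) ^ 2 =
        ∑ b, u j b ^ 2 * ∑ e : P4, if e j = b then pp m k e else 0 := by
      simp only [Finset.mul_sum]
      rw [Finset.sum_comm]
      refine Finset.sum_congr rfl fun e _ => ?_
      simp only [mul_ite, mul_zero]
      rw [Finset.sum_ite_eq]
      simp; ring
    have hfin : sl (m+1) (k j) * ∑ e, pp m k e * u j (e j) ^ 2 = NN (m+1) k * ∑ a, f j a ^ 2 := by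
      rw [hsum, sumCons, Finset.mul_sum, Finset.mul_sum]
      refine Finset.sum_congr rfl fun b _ => ?_
      rw [← hub b]
      linear_combination (- u j b ^ 2) * marg_s1 m k j b
    rw [← Real.sqrt_div (Finset.sum_nonneg fun _ _ => sq_nonneg _)]
    congr 1
    rw [div_eq_div_iff hN hsl]
    linarith


lemma prod_ww {n : ℕ} (A : Fin n → P4) :
    ∏ i, ww 0 (A i) = if col A 0 + col A 1 = col A 2 + col A 3 then (1:ℝ) else 0 := by
  have hz : ∀ a b c d : ZMod 2, a + b + c + d = 0 ↔ a + b = c + d := by decide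
  split_ifs with h
  · refine Finset.prod_eq_one fun i _ => ?_
    unfold ww
    rw [if_pos]
    rw [Fin.sum_univ_four]
    exact (hz _ _ _ _).2 (congrFun h i)
  · have : ∃ i, ∑ j, A i j ≠ 0 := by
      by_contra hc
      push Not at hc
      apply h
      funext i
      have := hc i
      rw [Fin.sum_univ_four] at this
      exact (hz _ _ _ _).1 this
    obtain ⟨i, hi⟩ := this
    refine Finset.prod_eq_zero (Finset.mem_univ i) ?_
    unfold ww; rw [if_neg hi]

lemma u2_eq {n : ℕ} (f : BV n → ℝ) :
    u2pow4 f = EE (fun _ => f) / ((2 : ℝ) ^ n) ^ 3 := by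
  unfold u2pow4 EE
  congr 1
  rw [← Equiv.sum_comp (Equiv.piComm (fun (_ : Fin 4) (_ : Fin n) => ZMod 2))]
  simp only [sumCons (n := 3), sumCons (n := 2), sumCons (n := 1), sumCons (n := 0),
    Finset.univ_unique, Finset.sum_singleton]
  refine Finset.sum_congr rfl fun a₁ _ => Finset.sum_congr rfl fun a₂ _ =>
    Finset.sum_congr rfl fun a₃ _ => Finset.sum_congr rfl fun a₄ _ => ?_
  rw [prod_ww, Fin.prod_univ_four]
  have e : ∀ (B : Fin 4 → Fin n → ZMod 2) j,
      col ((Equiv.piComm (fun (_ : Fin 4) (_ : Fin n) => ZMod 2)) B) j = B j := fun B j => rfl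
  simp only [e]
  change _ = (if a₁ + a₂ = a₃ + a₄ then (1:ℝ) else 0) * (f a₁ * f a₂ * f a₃ * f a₄)
  split_ifs <;> simp

lemma wt_eq {n : ℕ} (x : BV n) : hammingNorm x = wt x := by
  unfold hammingNorm wt
  rw [Finset.card_filter]
  refine Finset.sum_congr rfl fun i _ => ?_
  have : ∀ b : ZMod 2, (if b ≠ 0 then 1 else 0) = b.val := by decide
  exact this _

lemma ind_eq (n k : ℕ) :
    (fun x => if x ∈ hammingSphere n k then (1 : ℝ) else 0) = ind (m := n) (k : ℤ) := by
  funext x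
  unfold ind hammingSphere
  simp [wt_eq]

/-- Among functions supported on the Hamming sphere `A = S(n,k)`, the ratio
`‖f‖_{u₂}⁴/‖f‖₂⁴` is maximised at the indicator `𝟙_A`:
`‖f‖_{u₂}⁴ · ‖𝟙_A‖₂⁴ ≤ ‖𝟙_A‖_{u₂}⁴ · ‖f‖₂⁴`. -/
theorem u2_ratio_max_at_indicator (n k : ℕ) (hn : 1 ≤ n) (hk : k ≤ n)
    (f : BV n → ℝ) (hf : Function.support f ⊆ (hammingSphere n k : Set (BV n))) :
    u2pow4 f * (l2sq (fun x => if x ∈ hammingSphere n k then (1 : ℝ) else 0)) ^ 2 ≤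
      u2pow4 (fun x => if x ∈ hammingSphere n k then (1 : ℝ) else 0) * (l2sq f) ^ 2 := by
  rw [ind_eq, u2_eq, u2_eq]
  have hs : l2sq (ind (m := n) (k : ℤ)) = sl n k / (2:ℝ)^n := by
    unfold l2sq sl
    congr 1
    refine Finset.sum_congr rfl fun a _ => ?_
    unfold ind
    split_ifs <;> simp
  rw [hs]
  have hN : EE (fun _ : Fin 4 => ind (m := n) (k : ℤ)) = NN n (fun _ => k) := rfl
  rw [hN]
  have h1 : EE (fun _ : Fin 4 => f) ≤ EE (fun _ : Fin 4 => fun a => |f a|) := by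
    unfold EE
    refine Finset.sum_le_sum fun A _ => ?_
    refine mul_le_mul_of_nonneg_left ?_ (Finset.prod_nonneg fun _ _ => ww0_nonneg _)
    rw [← Finset.abs_prod]
    exact le_abs_self _
  have h2 := mainInd n (fun _ => (k:ℤ)) (fun _ : Fin 4 => fun a => |f a|) (fun _ _ => abs_nonneg _)
    (by
      intro _ a ha
      have : a ∈ Function.support f := by simpa using ha
      have := hf this
      simp only [hammingSphere, Finset.coe_filter, Finset.mem_univ, true_and] at this
      have h3 : hammingNorm a = k := this
      rw [wt_eq] at h3
      exact_mod_cast h3)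
  have hl : l2sq f = (∑ a, f a ^ 2) / (2:ℝ)^n := rfl
  rw [hl]
  simp only [sq_abs, Finset.prod_const, Finset.card_univ, Fintype.card_fin] at h2
  set X := ∑ a, f a ^ 2
  have hX : 0 ≤ X := Finset.sum_nonneg fun _ _ => sq_nonneg _
  have hN0 := NN_nonneg n (fun _ => (k:ℤ))
  rcases (sl_nonneg n k).lt_or_eq with h0 | h0
  · have e4 : (√X / √(sl n k))^4 = X^2 / (sl n k)^2 := by
      rw [div_pow, show √X^4 = (√X^2)^2 by ring, show √(sl n k)^4 = (√(sl n k)^2)^2 by ring,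
        Real.sq_sqrt hX, Real.sq_sqrt h0.le]
    rw [e4] at h2
    have h3 : EE (fun _ : Fin 4 => f) * (sl n k)^2 ≤ NN n (fun _ => (k:ℤ)) * X^2 := by
      have := h1.trans h2
      rw [mul_div_assoc', le_div_iff₀ (by positivity)] at this
      exact this
    have e5 : ∀ a b : ℝ, a / ((2:ℝ)^n)^3 * (b / (2:ℝ)^n)^2 = a * b^2 / ((2:ℝ)^n)^5 := by
      intro a b; field_simp
    rw [e5, e5]
    gcongr
  · rw [← h0]
    simp only [zero_div, ne_eq, OfNat.ofNat_ne_zero, not_false_eq_true, zero_pow, mul_zero]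
    positivity
end
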